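/- arXiv:1609.02250 — 5 statements merged into one kernel-verified Lean document; each statement's English description precedes it below -/
import Mathlib

section
/- The GL_5-invariants of (QP_5)_9 vanish: every homogeneous polynomial f of degree 9 in P_5 such that g·f − f is hit for every g in GL_5(F_2) is itself hit. -/
open MvPolynomial

noncomputable section

/-- The polynomial algebra `P_5 = F_2[x_1,...,x_5]`. -/
abbrev P5 : Type := MvPolynomial (Fin 5) (ZMod 2)

/-- The total Steenrod square: the `F_2`-algebra endomorphism with `Sq (x_i) = x_i + x_i ^ 2`. -/
def Sq : P5 →ₐ[ZMod 2] P5 := aeval fun i => X i + X i ^ 2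

/-- `f` (homogeneous of degree `n`) is hit if it is the degree-`n` homogeneous component of
`Sq g` for some `g` all of whose homogeneous components have degree `< n`. -/
def IsHit (n : ℕ) (f : P5) : Prop :=
  ∃ g : P5, (∀ m, n ≤ m → homogeneousComponent m g = 0) ∧
    f = homogeneousComponent n (Sq g)

/-- The subspace of hit polynomials of degree `n`. -/
def hitSpan (n : ℕ) : Submodule (ZMod 2) P5 :=
  Submodule.span (ZMod 2) {f : P5 | IsHit n f}

/-- The action of `GL_5(F_2)` on `P_5` by linear substitution of the variables. -/
def actGL (g : Matrix.GeneralLinearGroup (Fin 5) (ZMod 2)) : P5 →ₐ[ZMod 2] P5 :=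
  aeval fun i => ∑ j, ((g : Matrix (Fin 5) (Fin 5) (ZMod 2)) i j) • X j

/-- `wt d i` is the `(i+1)`-st entry `ω_{i+1}` of the weight vector of the monomial with
exponent vector `d`, i.e. the number of `j` such that bit `i` of `d j` is `1`. -/
def wt (d : Fin 5 →₀ ℕ) (i : ℕ) : ℕ :=
  (Finset.univ.filter fun j : Fin 5 => Nat.testBit (d j) i).card

/-- The weight vector of the exponent vector `d` equals the (finitely supported) list `w`. -/
def hasWt (d : Fin 5 →₀ ℕ) (w : List ℕ) : Prop :=
  ∀ i, wt d i = w.getD i 0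

/-- The weight vector of `d` is strictly smaller than `w` in left lexicographic order. -/
def wtLt (d : Fin 5 →₀ ℕ) (w : List ℕ) : Prop :=
  ∃ i, (∀ j, j < i → wt d j = w.getD j 0) ∧ wt d i < w.getD i 0

/-- `P_5^-(ω)`: the span of degree-`n` monomials whose weight vector is `< w`. -/
def PMinus (n : ℕ) (w : List ℕ) : Submodule (ZMod 2) P5 :=
  Submodule.span (ZMod 2)
    {x : P5 | ∃ d : Fin 5 →₀ ℕ, x = monomial d 1 ∧ (∑ j, d j) = n ∧ wtLt d w}

/-- `P_5(ω)`: the span of degree-`n` monomials whose weight vector is `≤ w`. -/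
def PLe (n : ℕ) (w : List ℕ) : Submodule (ZMod 2) P5 :=
  Submodule.span (ZMod 2)
    {x : P5 | ∃ d : Fin 5 →₀ ℕ, x = monomial d 1 ∧ (∑ j, d j) = n ∧ (wtLt d w ∨ hasWt d w)}

/-- The monomial `x_1^a x_2^b x_3^c x_4^d x_5^e`. -/
def mon (a b c d e : ℕ) : P5 :=
  X 0 ^ a * X 1 ^ b * X 2 ^ c * X 3 ^ d * X 4 ^ e

/-- The `i`-th binary digit of `n` as an element of `F_2`. -/
def bit (n i : ℕ) : ZMod 2 := if n.testBit i then 1 else 0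

lemma bit_zero (i : ℕ) : bit 0 i = 0 := by simp [bit]

lemma bit_xor (m n i : ℕ) : bit (m ^^^ n) i = bit m i + bit n i := by
  unfold bit
  rw [Nat.testBit_xor]
  cases m.testBit i <;> cases n.testBit i <;> decide

lemma bit_shiftLeft (m k i : ℕ) : bit (m <<< k) i = if k ≤ i then bit m (i - k) else 0 := by
  unfold bit
  rw [Nat.testBit_shiftLeft]
  by_cases h : k ≤ i <;> simp [h]

lemma bit_log2 {n : ℕ} (h : n ≠ 0) : bit n n.log2 = 1 := by
  simp [bit, Nat.testBit_log2 h]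

/-- Gaussian elimination test for linear independence of bit vectors over `F_2`; the first argument
bounds the number of elimination steps. -/
def bitIndep : ℕ → List ℕ → Bool
  | _, [] => true
  | 0, _ :: _ => false
  | k + 1, v :: l =>
    v != 0 && bitIndep k (l.map fun w => if w.testBit v.log2 then w ^^^ v else w)

lemma bit_reduce (v w p i : ℕ) :
    bit (if w.testBit p then w ^^^ v else w) i = bit w i + bit w p * bit v i := by
  by_cases h : w.testBit p
  · rw [if_pos h, bit_xor, bit, bit, bit]
    simp [h]
  · simp [h, bit]

lemma bitIndep_sound (k : ℕ) (l : List ℕ) (hl : bitIndep k l = true) (c : ℕ → ZMod 2)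
    (hc : ∀ i, ∑ j ∈ Finset.range l.length, c j * bit (l.getD j 0) i = 0) :
    ∀ j < l.length, c j = 0 := by
  induction k generalizing l c with
  | zero =>
    cases l with
    | nil => simp
    | cons v l => simp [bitIndep] at hl
  | succ k ih =>
    cases l with
    | nil => simp
    | cons v l =>
      simp only [bitIndep, Bool.and_eq_true, bne_iff_ne, ne_eq] at hl
      obtain ⟨hv, hl⟩ := hl
      simp only [List.length_cons, Finset.sum_range_succ', List.getD_cons_succ,
        List.getD_cons_zero] at hc
      have htail : ∀ i, ∑ j ∈ Finset.range l.length, c (j + 1) * bit (l.getD j 0) i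
          = c 0 * bit v i := fun i => CharTwo.add_eq_zero.mp (hc i)
      have hrest := ih _ hl (fun j => c (j + 1)) (fun i => by
        rw [List.length_map]
        have hterm : ∀ j ∈ Finset.range l.length,
            c (j + 1) * bit ((l.map fun w => if w.testBit v.log2 then w ^^^ v else w).getD j 0) i
              = c (j + 1) * bit (l.getD j 0) i
                + c (j + 1) * bit (l.getD j 0) v.log2 * bit v i := fun j hj => by
          have hj' : j < l.length := Finset.mem_range.mp hj
          simp only [List.getD_eq_getElem?_getD, List.getElem?_map, List.getElem?_eq_getElem hj',
            Option.map_some, Option.getD_some]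
          rw [bit_reduce]
          ring
        rw [Finset.sum_congr rfl hterm, Finset.sum_add_distrib, ← Finset.sum_mul, htail, htail,
          bit_log2 hv, mul_one]
        exact CharTwo.add_self_eq_zero _)
      rw [List.length_map] at hrest
      have h0 : c 0 = 0 := by
        have h := htail v.log2
        rw [bit_log2 hv, mul_one, Finset.sum_eq_zero] at h
        · exact h.symm
        · intro j hj
          rw [hrest j (Finset.mem_range.mp hj), zero_mul]
      intro j hj
      cases j with
      | zero => exact h0
      | succ j => exact hrest j (by simpa using hj)

/-- The code of an exponent vector: its entries are the decimal digits. -/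
def code (a b c d e : ℕ) : ℕ := a + 10 * b + 100 * c + 1000 * d + 10000 * e

/-- Apply a function of exponent vectors to the exponent vector with code `n`. -/
def onCode {α : Type} (F : ℕ → ℕ → ℕ → ℕ → ℕ → α) (n : ℕ) : α :=
  F (n % 10) (n / 10 % 10) (n / 100 % 10) (n / 1000 % 10) (n / 10000 % 10)

lemma onCode_code {α : Type} (F : ℕ → ℕ → ℕ → ℕ → ℕ → α) {a b c d e : ℕ}
    (h : a + b + c + d + e ≤ 9) : onCode F (code a b c d e) = F a b c d e := by
  unfold onCode code
  congr 1 <;> omega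

/-- The sum of the monomials whose codes are listed. -/
def codePoly (l : List ℕ) : P5 := (l.map (onCode mon)).sum

lemma codePoly_nil : codePoly [] = 0 := rfl

lemma codePoly_cons (n : ℕ) (l : List ℕ) : codePoly (n :: l) = onCode mon n + codePoly l := by
  simp [codePoly]

lemma codePoly_append (l l' : List ℕ) : codePoly (l ++ l') = codePoly l + codePoly l' := by
  simp [codePoly]

lemma codePoly_flatMap {α : Type} (l : List α) (F : α → List ℕ) :
    codePoly (l.flatMap F) = (l.map fun x => codePoly (F x)).sum := by
  induction l with
  | nil => rfl
  | cons x l ih => rw [List.flatMap_cons, codePoly_append, ih, List.map_cons, List.sum_cons]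

/-- The `k ≤ a` for which `a.choose k` is odd, for `a ≤ 9`. -/
def oddChoose : ℕ → List ℕ
  | 0 => [0]
  | 1 => [0, 1]
  | 2 => [0, 2]
  | 3 => [0, 1, 2, 3]
  | 4 => [0, 4]
  | 5 => [0, 1, 4, 5]
  | 6 => [0, 2, 4, 6]
  | 7 => [0, 1, 2, 3, 4, 5, 6, 7]
  | 8 => [0, 8]
  | 9 => [0, 1, 8, 9]
  | _ => []

lemma oddChoose_eq_filter {a : ℕ} (ha : a ≤ 9) :
    oddChoose a = (List.range (a + 1)).filter fun k => a.choose k % 2 == 1 := by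
  interval_cases a <;> decide +kernel

lemma le_of_mem_oddChoose {a k : ℕ} (ha : a ≤ 9) (hk : k ∈ oddChoose a) : k ≤ a := by
  rw [oddChoose_eq_filter ha] at hk
  exact Nat.lt_succ_iff.mp (List.mem_range.mp (List.mem_filter.mp hk).1)

lemma sum_filter_map {α M : Type} [AddCommMonoid M] (p : α → Bool) (F : α → M) (l : List α) :
    ((l.filter p).map F).sum = (l.map fun x => if p x then F x else 0).sum := by
  induction l with
  | nil => rfl
  | cons x l ih => by_cases h : p x <;> simp [h, ih]

lemma add_pow_oddChoose (x y : P5) {a : ℕ} (ha : a ≤ 9) :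
    (x + y) ^ a = ((oddChoose a).map fun k => x ^ (a - k) * y ^ k).sum := by
  have hrange : ∀ (n : ℕ) (F : ℕ → P5),
      ((List.range n).map F).sum = ∑ k ∈ Finset.range n, F k := fun _ _ => rfl
  rw [oddChoose_eq_filter ha, sum_filter_map, add_comm x y, add_pow, hrange]
  refine Finset.sum_congr rfl fun k _ => ?_
  rcases Nat.mod_two_eq_zero_or_one (a.choose k) with h | h
  · rw [(CharP.cast_eq_zero_iff P5 2 _).mpr (Nat.dvd_of_mod_eq_zero h)]
    simp [h]
  · rw [← Nat.div_add_mod (a.choose k) 2, h]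
    simp [CharTwo.two_eq_zero, mul_comm]

/-- The exponents of `(X + X ^ 2) ^ a` modulo `2`. -/
def sqExps (a : ℕ) : List ℕ := (oddChoose a).map (a + ·)

/-- The list `l` if `n ≤ 9`, and the empty list otherwise. -/
def ifLeNine (n : ℕ) (l : List ℕ) : List ℕ := bif Nat.ble n 9 then l else []

/-- The codes of the monomials of degree `9` in the total square of a monomial. -/
def sqCodes (a b c d e : ℕ) : List ℕ :=
  (sqExps a).flatMap fun a' => ifLeNine (a' + (b + c + d + e)) <|
    (sqExps b).flatMap fun b' => ifLeNine (a' + b' + (c + d + e)) <|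
      (sqExps c).flatMap fun c' => ifLeNine (a' + b' + c' + (d + e)) <|
        (sqExps d).flatMap fun d' => ifLeNine (a' + b' + c' + d' + e) <|
          (sqExps e).flatMap fun e' =>
            bif Nat.beq (a' + b' + c' + d' + e') 9 then [code a' b' c' d' e'] else []

lemma sqCodes_eq_flatMap (a b c d e : ℕ) :
    sqCodes a b c d e = (sqExps a).flatMap fun a' => (sqExps b).flatMap fun b' =>
      (sqExps c).flatMap fun c' => (sqExps d).flatMap fun d' => (sqExps e).flatMap fun e' =>
        bif Nat.beq (a' + b' + c' + d' + e') 9 then [code a' b' c' d' e'] else [] := by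
  have hle : ∀ {a k : ℕ}, k ∈ sqExps a → a ≤ k := fun hk => by
    obtain ⟨j, -, rfl⟩ := List.mem_map.mp hk
    omega
  have hguard : ∀ {n : ℕ} {l l' : List ℕ}, l = l' → (9 < n → l' = []) → ifLeNine n l = l' := by
    rintro n l _ rfl h
    unfold ifLeNine
    cases hn : Nat.ble n 9 with
    | true => rfl
    | false => exact (h (by simpa [← Bool.not_eq_true, Nat.ble_eq] using hn)).symm
  have hnil : ∀ {n : ℕ} {l : List ℕ}, n ≠ 9 → (bif Nat.beq n 9 then l else []) = [] :=
    fun {n l} h => by simp [Bool.cond_eq_ite, Nat.beq_eq, h]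
  refine List.flatMap_congr fun a' ha => hguard (List.flatMap_congr fun b' hb =>
    hguard (List.flatMap_congr fun c' hc => hguard (List.flatMap_congr fun d' hd =>
      hguard rfl ?_) ?_) ?_) ?_
  all_goals
    intro h
    simp only [List.flatMap_eq_nil_iff]
    intros
    refine hnil ?_
    grind

lemma Sq_X_pow (i : Fin 5) {a : ℕ} (ha : a ≤ 9) :
    Sq (X i ^ a) = ((sqExps a).map fun k => (X i : P5) ^ k).sum := by
  have hsub : ∀ k ∈ oddChoose a, (X i : P5) ^ (a - k) * (X i ^ 2) ^ k = X i ^ (a + k) :=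
    fun k hk => by
      have hk' := le_of_mem_oddChoose ha hk
      rw [← pow_mul, ← pow_add]
      congr 1
      omega
  rw [map_pow, Sq, aeval_X, add_pow_oddChoose _ _ ha, sqExps, List.map_map,
    List.map_congr_left hsub]
  rfl

lemma mon_eq_monomial (d : Fin 5 →₀ ℕ) :
    mon (d 0) (d 1) (d 2) (d 3) (d 4) = monomial d 1 := by
  rw [monomial_eq, Finsupp.prod_fintype _ _ (fun _ => pow_zero _), Fin.prod_univ_five, mon]
  simp

lemma exists_mon_eq_monomial (a b c d e : ℕ) : ∃ s : Fin 5 →₀ ℕ,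
    mon a b c d e = monomial s 1 ∧ s 0 = a ∧ s 1 = b ∧ s 2 = c ∧ s 3 = d ∧ s 4 = e :=
  ⟨Finsupp.equivFunOnFinite.symm ![a, b, c, d, e],
    mon_eq_monomial (Finsupp.equivFunOnFinite.symm ![a, b, c, d, e]), rfl, rfl, rfl, rfl, rfl⟩

lemma degree_eq_sum_five (s : Fin 5 →₀ ℕ) : s.degree = s 0 + s 1 + s 2 + s 3 + s 4 := by
  rw [Finsupp.degree_eq_sum, Fin.sum_univ_five]

lemma homogeneousComponent_mon (n a b c d e : ℕ) :
    homogeneousComponent n (mon a b c d e)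
      = if a + b + c + d + e = n then mon a b c d e else 0 := by
  obtain ⟨s, hs, rfl, rfl, rfl, rfl, rfl⟩ := exists_mon_eq_monomial a b c d e
  rw [hs, homogeneousComponent_of_mem (isHomogeneous_monomial (1 : ZMod 2) rfl),
    degree_eq_sum_five]
  simp only [eq_comm]

lemma homogeneousComponent_Sq_mon {a b c d e : ℕ} (h : a + b + c + d + e ≤ 9) :
    homogeneousComponent 9 (Sq (mon a b c d e)) = codePoly (sqCodes a b c d e) := by
  have hcode : ∀ a b c d e : ℕ, homogeneousComponent 9 ((X 0 : P5) ^ a * X 1 ^ b * X 2 ^ c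
      * X 3 ^ d * X 4 ^ e)
      = codePoly (bif Nat.beq (a + b + c + d + e) 9 then [code a b c d e] else []) := by
    intro a b c d e
    refine (homogeneousComponent_mon 9 a b c d e).trans ?_
    simp only [Bool.cond_eq_ite, Nat.beq_eq]
    split_ifs with h9
    · rw [codePoly_cons, codePoly_nil, add_zero, onCode_code _ h9.le]
    · rfl
  rw [mon, map_mul Sq, map_mul Sq, map_mul Sq, map_mul Sq, Sq_X_pow 0 (by omega),
    Sq_X_pow 1 (by omega), Sq_X_pow 2 (by omega), Sq_X_pow 3 (by omega), Sq_X_pow 4 (by omega)]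
  simp only [mul_assoc, ← List.sum_map_mul_right]
  simp only [← List.sum_map_mul_left]
  simp only [← mul_assoc, map_list_sum, List.map_map, Function.comp_def, hcode,
    sqCodes_eq_flatMap, codePoly_flatMap]

/-- The hit polynomials of degree `9`. -/
def hits : Submodule (ZMod 2) P5 where
  carrier := {f | IsHit 9 f}
  add_mem' := by
    rintro _ _ ⟨g, hg, rfl⟩ ⟨h, hh, rfl⟩
    exact ⟨g + h, fun m hm => by rw [map_add, hg m hm, hh m hm, add_zero],
      by rw [map_add, map_add]⟩
  zero_mem' := ⟨0, fun _ _ => map_zero _, by rw [map_zero, map_zero]⟩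
  smul_mem' := by
    rintro r _ ⟨g, hg, rfl⟩
    exact ⟨r • g, fun m hm => by rw [map_smul, hg m hm, smul_zero],
      by rw [map_smul, map_smul]⟩

lemma codePoly_sqCodes_mem_hits {a b c d e : ℕ} (h : a + b + c + d + e < 9) :
    codePoly (sqCodes a b c d e) ∈ hits := by
  refine ⟨mon a b c d e, fun m hm => ?_, (homogeneousComponent_Sq_mon h.le).symm⟩
  rw [homogeneousComponent_mon, if_neg (by omega)]

/-- The functional on `P_5` whose value at the monomial with code `n` is the `i`-th binary digit of
`row n`. -/
def rowForm (row : ℕ → ℕ) (i : ℕ) : P5 →ₗ[ZMod 2] ZMod 2 :=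
  (basisMonomials (Fin 5) (ZMod 2)).constr (ZMod 2) fun s =>
    bit (row (code (s 0) (s 1) (s 2) (s 3) (s 4))) i

lemma rowForm_monomial (row : ℕ → ℕ) (i : ℕ) (s : Fin 5 →₀ ℕ) :
    rowForm row i (monomial s 1) = bit (row (code (s 0) (s 1) (s 2) (s 3) (s 4))) i := by
  have hs : monomial s (1 : ZMod 2) = basisMonomials (Fin 5) (ZMod 2) s := by
    rw [coe_basisMonomials]
  rw [rowForm, hs, Module.Basis.constr_basis]

lemma rowForm_mon (row : ℕ → ℕ) (i a b c d e : ℕ) :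
    rowForm row i (mon a b c d e) = bit (row (code a b c d e)) i := by
  obtain ⟨s, hs, rfl, rfl, rfl, rfl, rfl⟩ := exists_mon_eq_monomial a b c d e
  rw [hs, rowForm_monomial]

/-- The bitwise sum of the rows of the listed codes. -/
def rowSum (row : ℕ → ℕ) (l : List ℕ) : ℕ := l.foldr (fun n s => row n ^^^ s) 0

lemma code_onCode {n : ℕ} (h : n < 100000) : onCode code n = n := by
  unfold onCode code
  omega

lemma rowForm_codePoly (row : ℕ → ℕ) (i : ℕ) (l : List ℕ) (hl : ∀ n ∈ l, n < 100000) :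
    rowForm row i (codePoly l) = bit (rowSum row l) i := by
  induction l with
  | nil => rw [codePoly_nil, map_zero, rowSum, List.foldr_nil, bit_zero]
  | cons n l ih =>
    have hn : rowForm row i (onCode mon n) = bit (row n) i := by
      rw [onCode, rowForm_mon]
      exact congrArg (fun m => bit (row m) i) (code_onCode (hl n List.mem_cons_self))
    rw [codePoly_cons, map_add, hn, ih fun m hm => hl m (List.mem_cons_of_mem _ hm),
      ← bit_xor, rowSum, rowSum, List.foldr_cons]

lemma lt_of_mem_sqCodes {a b c d e n : ℕ} (hn : n ∈ sqCodes a b c d e) : n < 100000 := by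
  simp only [sqCodes_eq_flatMap, List.mem_flatMap] at hn
  obtain ⟨a', -, b', -, c', -, d', -, e', -, hn⟩ := hn
  simp only [Bool.cond_eq_ite, Nat.beq_eq] at hn
  split_ifs at hn with h9
  · rw [List.mem_singleton.mp hn, code]
    omega
  · simp at hn

/-- The rows of the monomials of degree `9` in every total square of a monomial of smaller degree
sum to zero. -/
def killsHits (row : ℕ → ℕ) : Bool :=
  (List.range 9).all fun a => (List.range (9 - a)).all fun b =>
    (List.range (9 - a - b)).all fun c => (List.range (9 - a - b - c)).all fun d =>
      (List.range (9 - a - b - c - d)).all fun e => rowSum row (sqCodes a b c d e) == 0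

lemma rowForm_eq_zero_of_mem_hits {row : ℕ → ℕ} (hrow : killsHits row = true) (i : ℕ) {f : P5}
    (hf : f ∈ hits) : rowForm row i f = 0 := by
  obtain ⟨g, hg, rfl⟩ := hf
  simp only [killsHits, List.all_eq_true, List.mem_range, beq_iff_eq] at hrow
  rw [g.as_sum, map_sum, map_sum, map_sum]
  refine Finset.sum_eq_zero fun s hs => ?_
  have hdeg : s.degree < 9 := by
    by_contra! h
    have := congrArg (coeff s) (hg s.degree h)
    rw [coeff_homogeneousComponent, if_pos rfl, coeff_zero] at this
    exact mem_support_iff.mp hs this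
  rw [degree_eq_sum_five] at hdeg
  rw [← mul_one (coeff s g), ← smul_eq_mul, ← smul_monomial, map_smul, map_smul, map_smul,
    ← mon_eq_monomial, homogeneousComponent_Sq_mon hdeg.le,
    rowForm_codePoly _ _ _ fun n hn => lt_of_mem_sqCodes hn,
    hrow _ (by omega) _ (by omega) _ (by omega) _ (by omega) _ (by omega), bit_zero, smul_zero]

/-- Cancel equal pairs of entries. -/
def cancelPairs (l : List ℕ) : List ℕ :=
  l.foldr (fun n r => if n ∈ r then r.erase n else n :: r) []

lemma codePoly_cancelPairs (l : List ℕ) : codePoly (cancelPairs l) = codePoly l := by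
  induction l with
  | nil => rfl
  | cons n l ih =>
    rw [codePoly_cons, ← ih, cancelPairs, List.foldr_cons, ← cancelPairs]
    split_ifs with h
    · have herase : onCode mon n + codePoly ((cancelPairs l).erase n)
          = codePoly (cancelPairs l) := List.sum_map_erase (onCode mon) h
      rw [← herase, ← add_assoc, CharTwo.add_self_eq_zero, zero_add]
    · rw [codePoly_cons]

/-- Pass an evaluated natural number on to a continuation. -/
def withNat {α : Type} (n : ℕ) (k : ℕ → α) : α :=
  match n with
  | 0 => k 0
  | m + 1 => k (m + 1)

lemma withNat_eq {α : Type} (n : ℕ) (k : ℕ → α) : withNat n k = k n := by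
  cases n <;> rfl

/-- The sum of the total squares of the listed monomials, in degree `9`. -/
def hitCodes (gs : List ℕ) : List ℕ := gs.flatMap (onCode sqCodes)

/-- All monomials of degree `9` have their codes among the binary digits of `s`. -/
def allSolved (s : ℕ) : Bool :=
  (List.range 10).all fun a => (List.range (10 - a)).all fun b =>
    (List.range (10 - a - b)).all fun c => (List.range (10 - a - b - c)).all fun d =>
      s.testBit (code a b c d (9 - a - b - c - d))

/-- Starting from the monomials recorded in `s`, all monomials of degree `9` are obtained
successively, modulo hit polynomials, by solving the listed relations for one new monomial each. -/
def solvesAll : List (ℕ × List ℕ) → ℕ → Bool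
  | [], s => allSolved s
  | (n, gs) :: r, s =>
    (gs.all (onCode fun a b c d e => decide (a + b + c + d + e < 9)) &&
      (cancelPairs (hitCodes gs)).filter (fun m => !s.testBit m) == [n]) &&
      withNat (s ||| 1 <<< n) (solvesAll r)

lemma codePoly_hitCodes_mem_hits (gs : List ℕ)
    (hgs : gs.all (onCode fun a b c d e => decide (a + b + c + d + e < 9)) = true) :
    codePoly (hitCodes gs) ∈ hits := by
  rw [hitCodes, codePoly_flatMap]
  refine list_sum_mem fun x hx => ?_
  obtain ⟨g, hg, rfl⟩ := List.mem_map.mp hx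
  exact codePoly_sqCodes_mem_hits (of_decide_eq_true (List.all_eq_true.mp hgs g hg))

lemma codePoly_filter_add (p : ℕ → Bool) (l : List ℕ) :
    codePoly (l.filter p) + codePoly (l.filter fun n => !p n) = codePoly l := by
  induction l with
  | nil => simp [codePoly]
  | cons n l ih =>
    by_cases h : p n
    · simp [h, codePoly_cons, ← ih, add_assoc]
    · simp [h, codePoly_cons, ← ih, add_left_comm]

lemma solvesAll_sound {W : Submodule (ZMod 2) P5} (hW : hits ≤ W) (r : List (ℕ × List ℕ)) (s : ℕ)
    (hr : solvesAll r s = true) (hs : ∀ n, s.testBit n = true → onCode mon n ∈ W)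
    {a b c d e : ℕ} (h : a + b + c + d + e = 9) : mon a b c d e ∈ W := by
  induction r generalizing s with
  | nil =>
    simp only [solvesAll, allSolved, List.all_eq_true, List.mem_range] at hr
    have hbit := hr a (by omega) b (by omega) c (by omega) d (by omega)
    rw [show 9 - a - b - c - d = e by omega] at hbit
    rw [← onCode_code mon h.le]
    exact hs _ hbit
  | cons x r ih =>
    obtain ⟨n, gs⟩ := x
    simp only [solvesAll, withNat_eq, Bool.and_eq_true, beq_iff_eq] at hr
    obtain ⟨⟨hgs, hn⟩, hr⟩ := hr
    refine ih _ hr fun m hm => ?_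
    rw [Nat.testBit_or, Bool.or_eq_true, Nat.one_shiftLeft, Nat.testBit_two_pow,
      decide_eq_true_eq] at hm
    rcases hm with hm | rfl
    · exact hs m hm
    · have hhit : codePoly (cancelPairs (hitCodes gs)) ∈ W := by
        rw [codePoly_cancelPairs]
        exact hW (codePoly_hitCodes_mem_hits gs hgs)
      rw [← codePoly_filter_add s.testBit, hn, codePoly_cons, codePoly_nil, add_zero] at hhit
      refine (W.add_mem_iff_right (list_sum_mem fun x hx => ?_)).mp hhit
      obtain ⟨k, hk, rfl⟩ := List.mem_map.mp hx
      exact hs k (List.mem_filter.mp hk).2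

/-- Codes of 191 monomials that form a basis of the polynomials of degree `9` modulo hits. -/
def basisCodes : List ℕ :=
  [1053, 3051, 34110, 41013, 2511, 50310, 1215, 50031, 25101, 31104, 351, 21114, 11214, 50103,
   41103, 10314, 14211, 3510, 13005, 52011, 11052, 15030, 14112, 3501, 52101, 14121, 513, 15201,
   1305, 61101, 15021, 31005, 11421, 41301, 50211, 53100, 15102, 10341, 20511, 20115, 14013,
   25110, 10053, 33102, 51120, 11205, 3015, 15300, 4113, 10251, 33120, 53010, 31410, 5121, 5112,
   30141, 41130, 12501, 51030, 20151, 11502, 43011, 10332, 50112, 15120, 1116, 50130, 1521, 10125,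
   14310, 11106, 12150, 11250, 5130, 51012, 15210, 10161, 15012, 21051, 23130, 31041, 6111, 13023,
   10116, 31032, 30501, 31302, 1152, 11520, 50013, 3312, 21510, 31500, 31320, 12303, 11016, 1512,
   13302, 30123, 12330, 11061, 2151, 1161, 30132, 1332, 10503, 1530, 1323, 31203, 2133, 21033,
   30312, 31230, 23103, 3105, 53001, 3132, 20313, 10350, 23031, 3213, 10233, 32013, 33021, 13320,
   153, 31122, 32121, 32112, 12231, 22131, 11232, 12213, 11223, 22113, 21321, 22311, 11322, 23112,
   23211, 13122, 70101, 1017, 1107, 3033, 13131, 3330, 1701, 30330, 13113, 10107, 71010, 11331,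
   11133, 171, 33111, 11313, 1710, 31113, 30303, 31131, 10071, 7101, 11070, 31311, 70011, 10170,
   10710, 11700, 711, 7110, 17001, 33300, 10017, 333, 30033, 33003, 10701, 33030, 7011, 1071,
   17100, 11007, 3303, 117, 70110, 17010, 71001, 13311, 1170, 71100]

/-- Relations solving for the remaining monomials of degree `9`: each pair consists of the code of
a monomial and the codes of the monomials whose total squares express it modulo hits. -/
def relations : List (ℕ × List ℕ) :=
  [(9, [7]), (18, [16]), (27, [17]), (108, [106]), (207, [107]), (1008, [1006]), (2007, [1007]),
   (10008, [10006]), (20007, [10007]), (45, [25]), (36, [35]), (405, [205]), (306, [305]), (4005,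
   [2005]), (3006, [3005]), (40005, [20005]), (30006, [30005]), (54, [34]), (63, [53]), (144,
   [124]), (234, [134]), (243, [233]), (1044, [1024]), (2034, [1034]), (2043, [2033]), (10044,
   [10024]), (20034, [10034]), (20043, [20033]), (414, [214]), (324, [314]), (423, [323]), (225,
   [223]), (126, [125]), (216, [116]), (4014, [2014]), (3024, [3014]), (4023, [3023]), (2025,
   [2023]), (1026, [1025]), (2016, [1016]), (40014, [20014]), (30024, [30014]), (40023, [30023]),
   (20025, [20023]), (10026, [10025]), (20016, [10016]), (504, [304]), (603, [503]), (1404,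
   [1204]), (2304, [1304]), (2403, [2303]), (10404, [10204]), (20304, [10304]), (20403, [20303]),
   (4104, [2104]), (3204, [3104]), (4203, [3203]), (2205, [2203]), (1206, [1205]), (2106, [1106]),
   (40104, [20104]), (30204, [30104]), (40203, [30203]), (20205, [20203]), (10206, [10205]),
   (20106, [10106]), (5004, [3004]), (6003, [5003]), (14004, [12004]), (23004, [13004]), (24003,
   [23003]), (41004, [21004]), (32004, [31004]), (42003, [32003]), (22005, [22003]), (12006,
   [12005]), (21006, [11006]), (50004, [30004]), (60003, [50003]), (81, [61]), (72, [71]), (441,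
   [241]), (342, [341]), (432, [332]), (252, [232]), (162, [152]), (261, [161]), (522, [322]),
   (612, [512]), (621, [611]), (4041, [2041]), (3042, [3041]), (4032, [3032]), (2052, [2032]),
   (1062, [1052]), (2061, [1061]), (5022, [3022]), (6012, [5012]), (6021, [6011]), (40041,
   [20041]), (30042, [30041]), (40032, [30032]), (20052, [20032]), (10062, [10052]), (20061,
   [10061]), (50022, [30022]), (60012, [50012]), (60021, [60011]), (801, [601]), (702, [701]),
   (4401, [2401]), (3402, [3401]), (4302, [3302]), (2502, [2302]), (1602, [1502]), (2601, [1601]),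
   (5202, [3202]), (6102, [5102]), (6201, [6101]), (40401, [20401]), (30402, [30401]), (40302,
   [30302]), (20502, [20302]), (10602, [10502]), (20601, [10601]), (50202, [30202]), (60102,
   [50102]), (60201, [60101]), (8001, [6001]), (7002, [7001]), (44001, [24001]), (34002, [34001]),
   (43002, [33002]), (25002, [23002]), (16002, [15002]), (26001, [16001]), (52002, [32002]),
   (61002, [51002]), (62001, [61001]), (80001, [60001]), (70002, [70001]), (90, [70]), (180,
   [160]), (270, [170]), (1080, [1060]), (2070, [1070]), (10080, [10060]), (20070, [10070]), (450,
   [250]), (360, [350]), (4050, [2050]), (3060, [3050]), (40050, [20050]), (30060, [30050]), (540,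
   [340]), (630, [530]), (1440, [1240]), (2340, [1340]), (2430, [2330]), (10440, [10240]), (20340,
   [10340]), (20430, [20330]), (4140, [2140]), (3240, [3140]), (4230, [3230]), (2250, [2230]),
   (1260, [1250]), (2160, [1160]), (40140, [20140]), (30240, [30140]), (40230, [30230]), (20250,
   [20230]), (10260, [10250]), (20160, [10160]), (5040, [3040]), (6030, [5030]), (14040, [12040]),
   (23040, [13040]), (24030, [23030]), (41040, [21040]), (32040, [31040]), (42030, [32030]),
   (22050, [22030]), (12060, [12050]), (21060, [11060]), (50040, [30040]), (60030, [50030]), (810,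
   [610]), (720, [710]), (4410, [2410]), (3420, [3410]), (4320, [3320]), (2520, [2320]), (1620,
   [1520]), (2610, [1610]), (5220, [3220]), (6120, [5120]), (6210, [6110]), (40410, [20410]),
   (30420, [30410]), (40320, [30320]), (20520, [20320]), (10620, [10520]), (20610, [10610]),
   (50220, [30220]), (60120, [50120]), (60210, [60110]), (8010, [6010]), (7020, [7010]), (44010,
   [24010]), (34020, [34010]), (43020, [33020]), (25020, [23020]), (16020, [15020]), (26010,
   [16010]), (52020, [32020]), (61020, [51020]), (62010, [61010]), (80010, [60010]), (70020,
   [70010]), (900, [700]), (1800, [1600]), (2700, [1700]), (10800, [10600]), (20700, [10700]),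
   (4500, [2500]), (3600, [3500]), (40500, [20500]), (30600, [30500]), (5400, [3400]), (6300,
   [5300]), (14400, [12400]), (23400, [13400]), (24300, [23300]), (41400, [21400]), (32400,
   [31400]), (42300, [32300]), (22500, [22300]), (12600, [12500]), (21600, [11600]), (50400,
   [30400]), (60300, [50300]), (8100, [6100]), (7200, [7100]), (44100, [24100]), (34200, [34100]),
   (43200, [33200]), (25200, [23200]), (16200, [15200]), (26100, [16100]), (52200, [32200]),
   (61200, [51200]), (62100, [61100]), (80100, [60100]), (70200, [70100]), (9000, [7000]), (18000,
   [16000]), (27000, [17000]), (45000, [25000]), (36000, [35000]), (54000, [34000]), (63000,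
   [53000]), (81000, [61000]), (72000, [71000]), (90000, [70000]), (1422, [1411, 2411]), (2322,
   [1322]), (2412, [2312]), (2421, [2411]), (12240, [11140, 21140]), (21240, [11240]), (22140,
   [21140]), (22230, [22130]), (4122, [2211, 4111]), (3222, [3122]), (4212, [3212]), (4221,
   [4211]), (2241, [2221]), (1242, [1241]), (2142, [1142]), (2232, [2132]), (2124, [2122]), (1224,
   [1124]), (2214, [1214]), (2223, [2213]), (20412, [10411, 10421]), (10422, [10412]), (20322,
   [10322]), (20421, [20321]), (10242, [10141, 20141]), (20142, [10142]), (20232, [20132]),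
   (20241, [20231]), (40221, [20221]), (30222, [30221]), (40122, [30122]), (40212, [40112]),
   (20214, [20212]), (10224, [10214]), (20124, [10124]), (20223, [20123]), (12402, [11401,
   21401]), (21402, [11402]), (22302, [21302]), (22401, [22301]), (41202, [21101, 42101]), (32202,
   [31202]), (42102, [32102]), (42201, [42101]), (24201, [22201]), (14202, [14201]), (23202,
   [13202]), (24102, [23102]), (22104, [22102]), (12204, [12104]), (21204, [11204]), (22203,
   [21203]), (12024, [11014, 21014]), (21024, [11024]), (22014, [21014]), (22023, [22013]),
   (14220, [14110, 24110]), (23220, [13220]), (24120, [23120]), (24210, [24110]), (42120,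
   [22120]), (32220, [32120]), (41220, [31220]), (42210, [41210]), (22410, [22210]), (12420,
   [12410]), (21420, [11420]), (22320, [21320]), (14022, [12011, 24011]), (23022, [13022]),
   (24012, [23012]), (24021, [24011]), (42012, [22012]), (32022, [32012]), (41022, [31022]),
   (42021, [41021]), (22041, [22021]), (12042, [12041]), (21042, [11042]), (22032, [21032]),
   (22122, [11111, 12221, 21212]), (12222, [12122]), (21222, [11222]), (22212, [21212]), (22221,
   [22211]), (1035, [1033]), (5031, [3031]), (52110, [32110]), (21015, [21013]), (4311, [2311]),
   (30510, [30310]), (1413, [1213]), (30051, [30031]), (43101, [23101]), (51102, [31102]), (531,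
   [331]), (41112, [21112]), (11412, [11212]), (30105, [30103]), (21105, [21103]), (10512,
   [10312]), (12411, [12211]), (5310, [3310]), (15003, [13003]), (34011, [32011]), (11034,
   [11032]), (13050, [13030]), (12114, [12112]), (11124, [11114]), (11142, [11122]), (5301,
   [3301]), (34101, [32101]), (24111, [14111]), (42111, [22111]), (12141, [12121]), (315, [313]),
   (13401, [13201]), (1503, [1303]), (51201, [51101]), (31401, [31201]), (13041, [13021]), (51003,
   [31003]), (21411, [11411]), (41211, [21211]), (41121, [41111]), (21141, [21121]), (11241,
   [11141]), (21501, [21301]), (30411, [30211]), (35100, [33100]), (16101, [15101]), (13104,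
   [13102]), (10521, [10321]), (10611, [10511]), (40311, [20311]), (40113, [20113]), (12015,
   [12013]), (43110, [23110]), (10035, [10033]), (33201, [33101]), (31140, [31120]), (11403,
   [11203]), (5013, [3013]), (13500, [13300]), (2115, [2113]), (10431, [10231]), (33210, [33110]),
   (35010, [33010]), (51210, [31210]), (61110, [51110]), (3141, [3121]), (3114, [3112]), (50121,
   [30121]), (21150, [21130]), (14301, [12301]), (31050, [31030]), (40131, [20131]), (11601,
   [11501]), (11304, [11302]), (25011, [23011]), (20331, [10331]), (60111, [50111]), (30114,
   [30112]), (13140, [13120]), (1125, [1115]), (1143, [1123]), (30150, [30130]), (1341, [1321]),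
   (10143, [10123]), (12510, [12310]), (12105, [11105]), (14103, [12103]), (14130, [12130]),
   (11160, [11150]), (11430, [11230]), (3150, [3130]), (31014, [31012]), (16110, [15110]), (13410,
   [13210]), (10152, [10151]), (10134, [10132]), (16011, [15011]), (13014, [13012]), (41031,
   [21031]), (13230, [13130]), (51021, [31021]), (61011, [51011]), (5211, [5111]), (3411, [3211]),
   (23013, [13013]), (10215, [10115]), (10413, [10213]), (32031, [31031]), (50301, [30301]),
   (32301, [31301]), (1134, [1132]), (11340, [11320]), (30015, [30013]), (3321, [3311]), (11610,
   [11510]), (41310, [21310]), (51300, [31300]), (32310, [31310]), (21303, [11303]), (11025,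
   [11015]), (11043, [11023]), (1611, [1511]), (1314, [1312]), (23301, [13301]), (30213, [30113]),
   (21330, [11330]), (12051, [11051]), (14031, [12031]), (4131, [2131]), (1251, [1151]), (1431,
   [1231]), (30231, [30131]), (2331, [1331]), (10305, [10303]), (1350, [1330]), (2313, [1313]),
   (32103, [31103]), (1233, [1133]), (12033, [11033]), (30321, [30311]), (32130, [31130]), (13203,
   [13103]), (5103, [3103]), (35001, [33001]), (3231, [3131]), (10323, [10313]), (10530, [10330]),
   (13032, [13031]), (3123, [3113]), (20133, [10133]), (31023, [31013]), (33012, [33011]), (23310,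
   [13310]), (135, [133]), (31221, [31121]), (31212, [31112]), (32211, [31211]), (51111, [31111]),
   (12132, [12131]), (21132, [11132]), (21231, [21131]), (11151, [11131]), (21213, [11213]),
   (12123, [12113]), (21123, [11123]), (11115, [11113]), (21312, [21311]), (12312, [11312]),
   (12321, [12311]), (11511, [11311]), (23121, [23111]), (13212, [13112]), (13221, [13211]),
   (15111, [13111])]

/-- The codes are pairwise incongruent modulo this number in degree `9`. -/
def slotCount : ℕ := 3626

/-- The number of binary digits reserved for a row. -/
def width : ℕ := 191

/-- The row of the monomial with code `n` in the table `t`. -/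
def tableRow (t n : ℕ) : ℕ := (t >>> (width * (n % slotCount))) % 2 ^ width

/-- Store the row `v` for the monomial with code `n` in the table `t`. -/
def tableSet (t n v : ℕ) : ℕ := t ||| v <<< (width * (n % slotCount))

/-- Store the unit vectors, starting with the `j`-th one, as rows of the listed monomials. -/
def tableInit : List ℕ → ℕ → ℕ → ℕ
  | [], _, t => t
  | n :: l, j, t => withNat (tableSet t n (1 <<< j)) (tableInit l (j + 1))

/-- Extend a table by the rows determined by the listed relations. -/
def tableExtend : List (ℕ × List ℕ) → ℕ → ℕ
  | [], t => t
  | (n, gs) :: r, t => withNat (tableSet t n (rowSum (tableRow t) (hitCodes gs))) (tableExtend r)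

/-- The codes of the monomials in `(x_1 + x_2) ^ a x_2 ^ b x_3 ^ c x_4 ^ d x_5 ^ e`. -/
def transvectCodes (a b c d e : ℕ) : List ℕ :=
  (oddChoose a).map fun k => code (a - k) (b + k) c d e

/-- The coordinates of the changes of the monomial with code `n` under the cyclic permutation of the
variables and under the transvection `x_1 ↦ x_1 + x_2`. -/
def changeRow (row : ℕ → ℕ) (n : ℕ) : ℕ :=
  rowSum row (onCode (fun a b c d e => [code e a b c d, code a b c d e]) n) ^^^
    rowSum row (onCode (fun a b c d e => code a b c d e :: transvectCodes a b c d e) n) <<< width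

/-- The rows vanish on hits, and no nonzero combination of the basis monomials is invariant. -/
def tableValid (t : ℕ) : Bool :=
  killsHits (tableRow t) && bitIndep width (basisCodes.map (changeRow (tableRow t)))

lemma exists_tableValid : ∃ t, tableValid t = true := by
  have h : withNat (tableInit basisCodes 0 0) (fun t => withNat (tableExtend relations t)
      tableValid) = true := by decide +kernel
  rw [withNat_eq, withNat_eq] at h
  exact ⟨_, h⟩

lemma solvesAll_relations :
    solvesAll relations (basisCodes.foldl (fun s n => s ||| 1 <<< n) 0) = true := by
  decide +kernel

lemma degree_basisCodes_le :
    ∀ n ∈ basisCodes, onCode (fun a b c d e => a + b + c + d + e) n ≤ 9 := by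
  have h : basisCodes.all (onCode fun a b c d e => decide (a + b + c + d + e ≤ 9)) = true := by
    decide +kernel
  exact fun n hn => of_decide_eq_true (List.all_eq_true.mp h n hn)

/-- The cyclic permutation `x_i ↦ x_{i+1}` of the variables. -/
def cyclic : Matrix.GeneralLinearGroup (Fin 5) (ZMod 2) where
  val := Matrix.of fun i j => if j = i + 1 then 1 else 0
  inv := Matrix.of fun i j => if i = j + 1 then 1 else 0
  val_inv := by decide +kernel
  inv_val := by decide +kernel

/-- The substitution `x_1 ↦ x_1 + x_2` fixing the other variables. -/
def transvection : Matrix.GeneralLinearGroup (Fin 5) (ZMod 2) where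
  val := Matrix.of fun i j => if i = j ∨ i = 0 ∧ j = 1 then 1 else 0
  inv := Matrix.of fun i j => if i = j ∨ i = 0 ∧ j = 1 then 1 else 0
  val_inv := by decide +kernel
  inv_val := by decide +kernel

lemma actGL_cyclic_mon (a b c d e : ℕ) : actGL cyclic (mon a b c d e) = mon e a b c d := by
  simp [actGL, mon, cyclic]
  ring

lemma actGL_transvection_mon {a b c d e : ℕ} (h : a + b + c + d + e ≤ 9) :
    actGL transvection (mon a b c d e) = codePoly (transvectCodes a b c d e) := by
  have hact : actGL transvection (mon a b c d e)
      = (X 0 + X 1) ^ a * (X 1 ^ b * X 2 ^ c * X 3 ^ d * X 4 ^ e) := by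
    simp [actGL, mon, transvection, Fin.sum_univ_five]
    ring
  rw [hact, add_pow_oddChoose _ _ (by omega), ← List.sum_map_mul_right, codePoly, transvectCodes,
    List.map_map]
  congr 1
  refine List.map_congr_left fun k hk => ?_
  have hk' := le_of_mem_oddChoose (by omega) hk
  rw [Function.comp_apply, onCode_code _ (by omega), mon]
  ring

lemma lt_of_mem_transvectCodes {a b c d e n : ℕ} (h : a + b + c + d + e ≤ 9)
    (hn : n ∈ transvectCodes a b c d e) : n < 100000 := by
  obtain ⟨k, hk, rfl⟩ := List.mem_map.mp hn
  have hk' := le_of_mem_oddChoose (by omega) hk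
  unfold code
  omega

lemma actGL_Sq (g : Matrix.GeneralLinearGroup (Fin 5) (ZMod 2)) (p : P5) :
    actGL g (Sq p) = Sq (actGL g p) := by
  have hsq : ∀ r : ZMod 2, r ^ 2 = r := by decide
  have h : (actGL g).comp Sq = Sq.comp (actGL g) := by
    refine algHom_ext fun i => ?_
    simp only [AlgHom.comp_apply, Sq, actGL, aeval_X, map_add, map_pow, map_sum, map_smul,
      CharTwo.sum_sq, smul_pow, hsq, smul_add, Finset.sum_add_distrib]
  exact DFunLike.congr_fun h p

lemma isHomogeneous_actGL (g : Matrix.GeneralLinearGroup (Fin 5) (ZMod 2)) {p : P5} {n : ℕ}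
    (hp : p.IsHomogeneous n) : (actGL g p).IsHomogeneous n := by
  rw [← one_mul n]
  refine hp.aeval _ fun i => IsHomogeneous.sum _ _ _ fun j _ => ?_
  rw [smul_eq_C_mul]
  exact (isHomogeneous_X _ _).C_mul _

lemma homogeneousComponent_actGL (g : Matrix.GeneralLinearGroup (Fin 5) (ZMod 2)) (n : ℕ)
    (p : P5) : homogeneousComponent n (actGL g p) = actGL g (homogeneousComponent n p) := by
  induction p using MvPolynomial.induction_on' with
  | monomial s r =>
    have hs : (monomial s r : P5).IsHomogeneous s.degree := isHomogeneous_monomial r rfl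
    rw [homogeneousComponent_of_mem (isHomogeneous_actGL g hs), homogeneousComponent_of_mem hs]
    split_ifs <;> simp
  | add p q hp hq => simp only [map_add, hp, hq]

lemma actGL_mem_hits (g : Matrix.GeneralLinearGroup (Fin 5) (ZMod 2)) {f : P5} (hf : f ∈ hits) :
    actGL g f ∈ hits := by
  obtain ⟨p, hp, rfl⟩ := hf
  exact ⟨actGL g p, fun m hm => by rw [homogeneousComponent_actGL, hp m hm, map_zero],
    by rw [← homogeneousComponent_actGL, actGL_Sq]⟩

/-- The digits of `changeRow row n` are the values of the row functionals on the changes of a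
monomial under the two group elements. -/
lemma bit_changeRow (row : ℕ → ℕ) {n : ℕ}
    (hn : onCode (fun a b c d e => a + b + c + d + e) n ≤ 9) (i : ℕ) :
    bit (changeRow row n) i =
      rowForm row i (actGL cyclic (onCode mon n) - onCode mon n)
        + if width ≤ i then
            rowForm row (i - width) (actGL transvection (onCode mon n) - onCode mon n) else 0 := by
  have hcode : ∀ {a b c d e : ℕ}, a + b + c + d + e ≤ 9 → code a b c d e < 100000 := by
    intro a b c d e h
    unfold code
    omega
  rw [changeRow, bit_xor, bit_shiftLeft]
  simp only [onCode] at hn ⊢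
  generalize n % 10 = a, n / 10 % 10 = b, n / 100 % 10 = c, n / 1000 % 10 = d,
    n / 10000 % 10 = e at hn
  have hn' : e + a + b + c + d ≤ 9 := by omega
  rw [← rowForm_codePoly row i, ← rowForm_codePoly row (i - width)]
  · rw [codePoly_cons, codePoly_cons, codePoly_cons, codePoly_nil, add_zero, onCode_code _ hn,
      onCode_code _ hn', actGL_cyclic_mon, actGL_transvection_mon hn, CharTwo.sub_eq_add,
      CharTwo.sub_eq_add, add_comm (mon a b c d e)]
  · intro m hm
    rcases List.mem_cons.mp hm with rfl | hm
    · exact hcode hn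
    · exact lt_of_mem_transvectCodes hn hm
  · intro m hm
    rcases List.mem_cons.mp hm with rfl | hm
    · exact hcode hn'
    · rw [List.mem_singleton.mp hm]
      exact hcode hn

/-- If relations solve for all monomials outside a list, then every polynomial of degree `9` is,
modulo hits, a combination of the monomials in the list. -/
lemma exists_sub_sum_mem_hits {B : List ℕ} {r : List (ℕ × List ℕ)}
    (hr : solvesAll r (B.foldl (fun s n => s ||| 1 <<< n) 0) = true) {f : P5}
    (hf : f.IsHomogeneous 9) :
    ∃ c : ℕ → ZMod 2, f - ∑ j ∈ Finset.range B.length, c j • onCode mon (B.getD j 0) ∈ hits := by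
  let W : Submodule (ZMod 2) P5 := hits ⊔ Submodule.span (ZMod 2)
    (Set.range fun j : Fin B.length => onCode mon (B.getD j 0))
  have hinit : ∀ (l : List ℕ) (s : ℕ), (∀ n, s.testBit n = true → onCode mon n ∈ W) →
      (∀ n ∈ l, n ∈ B) →
      ∀ n, (l.foldl (fun s n => s ||| 1 <<< n) s).testBit n = true → onCode mon n ∈ W := by
    intro l
    induction l with
    | nil => exact fun s hs _ => hs
    | cons m l ih =>
      intro s hs hl
      refine ih _ (fun n hn => ?_) fun n hn => hl n (List.mem_cons_of_mem _ hn)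
      rw [Nat.testBit_or, Bool.or_eq_true, Nat.one_shiftLeft, Nat.testBit_two_pow,
        decide_eq_true_eq] at hn
      rcases hn with hn | rfl
      · exact hs n hn
      · obtain ⟨j, hj, rfl⟩ := List.getElem_of_mem (hl m List.mem_cons_self)
        refine Submodule.mem_sup_right (Submodule.subset_span ⟨⟨j, hj⟩, ?_⟩)
        exact congrArg (onCode mon) (List.getD_eq_getElem _ _ hj)
  have hW : f ∈ W := by
    rw [f.as_sum]
    refine W.sum_mem fun s hs => ?_
    have hdeg : s.degree = 9 := by
      by_contra h
      exact mem_support_iff.mp hs (hf.coeff_eq_zero h)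
    rw [← mul_one (coeff s f), ← smul_eq_mul, ← smul_monomial, ← mon_eq_monomial]
    refine W.smul_mem _ (solvesAll_sound le_sup_left _ _ hr
      (hinit B 0 (by simp) fun _ => id) ?_)
    rw [← degree_eq_sum_five, hdeg]
  obtain ⟨h, hh, v, hv, rfl⟩ := Submodule.mem_sup.mp hW
  obtain ⟨c, rfl⟩ := (Submodule.mem_span_range_iff_exists_fun _).mp hv
  refine ⟨fun j => if hj : j < B.length then c ⟨j, hj⟩ else 0, ?_⟩
  rw [Finset.sum_range]
  simpa using hh

/-- If row functionals vanish on hits and detect the changes of a list of monomials under two group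
elements, then an invariant combination of these monomials modulo hits is hit. -/
lemma isHit_of_bitIndep {row : ℕ → ℕ} {B : List ℕ} {k : ℕ} (hrow : killsHits row = true)
    (hindep : bitIndep k (B.map (changeRow row)) = true)
    (hdeg : ∀ n ∈ B, onCode (fun a b c d e => a + b + c + d + e) n ≤ 9) {f : P5}
    (hspan : ∃ c : ℕ → ZMod 2,
      f - ∑ j ∈ Finset.range B.length, c j • onCode mon (B.getD j 0) ∈ hits)
    (hinv : ∀ g : Matrix.GeneralLinearGroup (Fin 5) (ZMod 2), IsHit 9 (actGL g f - f)) :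
    IsHit 9 f := by
  obtain ⟨c, hc⟩ := hspan
  set v := ∑ j ∈ Finset.range B.length, c j • onCode mon (B.getD j 0) with hv
  have hvinv : ∀ g i, rowForm row i (actGL g v - v) = 0 := fun g i => by
    refine rowForm_eq_zero_of_mem_hits hrow i ?_
    have h := hits.sub_mem (hinv g) (hits.sub_mem (actGL_mem_hits g hc) hc)
    rw [map_sub] at h
    convert h using 1
    abel
  have hc0 := bitIndep_sound _ _ hindep c fun i => by
    have hterm : ∀ j ∈ Finset.range B.length,
        c j * bit ((B.map (changeRow row)).getD j 0) i
          = c j * rowForm row i (actGL cyclic (onCode mon (B.getD j 0))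
              - onCode mon (B.getD j 0))
            + if width ≤ i then c j * rowForm row (i - width)
                (actGL transvection (onCode mon (B.getD j 0))
                  - onCode mon (B.getD j 0)) else 0 := fun j hj => by
      have hj' : j < B.length := Finset.mem_range.mp hj
      rw [List.getD_eq_getElem _ _ (by rwa [List.length_map]), List.getElem_map,
        List.getD_eq_getElem _ _ hj', bit_changeRow _ (hdeg _ (List.getElem_mem hj')), mul_add,
        mul_ite, mul_zero]
    have hlin : ∀ g i, ∑ j ∈ Finset.range B.length,
        c j * rowForm row i (actGL g (onCode mon (B.getD j 0))
          - onCode mon (B.getD j 0)) = 0 := fun g i => by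
      rw [← hvinv g i, hv, map_sum, ← Finset.sum_sub_distrib, map_sum]
      refine Finset.sum_congr rfl fun j _ => ?_
      rw [map_smul, ← smul_sub, map_smul, smul_eq_mul]
    rw [List.length_map, Finset.sum_congr rfl hterm, Finset.sum_add_distrib, hlin, zero_add]
    split_ifs
    · exact hlin _ _
    · exact Finset.sum_const_zero
  have hv0 : v = 0 := Finset.sum_eq_zero fun j hj => by
    rw [hc0 j (by rw [List.length_map]; exact Finset.mem_range.mp hj), zero_smul]
  rw [hv0, sub_zero] at hc
  exact hc

/-- The GL_5-invariants of (QP_5)_9 vanish. -/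
theorem stmt5 (f : P5)
    (hf : f ∈ homogeneousSubmodule (Fin 5) (ZMod 2) 9)
    (hinv : ∀ g : Matrix.GeneralLinearGroup (Fin 5) (ZMod 2), IsHit 9 (actGL g f - f)) :
    IsHit 9 f := by
  obtain ⟨t, ht⟩ := exists_tableValid
  rw [tableValid, Bool.and_eq_true] at ht
  exact isHit_of_bitIndep ht.1 ht.2 degree_basisCodes_le
    (exists_sub_sum_mem_hits solvesAll_relations hf) hinv
end
end

section
/- Every homogeneous polynomial of degree 9 in P_5 can be written as the sum of a hit polynomial and an F_2-linear combination of monomials of degree 9 whose weight vector is (3,1,1,0,0,...), (3,3,0,0,...) or (5,2,0,0,...). -/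
open MvPolynomial

noncomputable section

/-- The hit polynomials of degree `n` form a subspace. -/
def hitSubmodule (n : ℕ) : Submodule (ZMod 2) P5 where
  carrier := {f | IsHit n f}
  zero_mem' := ⟨0, by simp, by simp⟩
  add_mem' := by
    rintro _ _ ⟨g, hg, rfl⟩ ⟨g', hg', rfl⟩
    exact ⟨g + g', fun m hm => by simp [hg m hm, hg' m hm], by simp⟩
  smul_mem' := by
    rintro c _ ⟨g, hg, rfl⟩
    exact ⟨c • g, fun m hm => by simp [hg m hm], by simp⟩

theorem Sq_X (i : Fin 5) : Sq (X i) = X i + X i ^ 2 := by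
  simp [Sq]

/-- The Cartan formula for a product of variables. -/
theorem Sq_prod_X {ι : Type*} [Fintype ι] (v : ι → Fin 5) :
    Sq (∏ k, X (v k)) =
      ∑ t : Finset ι, (∏ k, X (v k)) * ∏ k ∈ t, (X (v k) : P5) := by
  classical
  rw [map_prod, ← Finset.mul_sum, ← Finset.powerset_univ, ← Finset.prod_one_add,
    ← Finset.prod_mul_distrib]
  exact Finset.prod_congr rfl fun k _ => by rw [Sq_X]; ring

theorem isHomogeneous_prod_X {ι : Type*} (s : Finset ι) (v : ι → Fin 5) :
    (∏ k ∈ s, (X (v k) : P5)).IsHomogeneous s.card := by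
  simpa using IsHomogeneous.prod s (fun k => (X (v k) : P5)) (fun _ => 1)
    fun k _ => isHomogeneous_X _ (v k)

theorem homogeneousComponent_of_isHomogeneous {p : P5} {n : ℕ} (hp : p.IsHomogeneous n) (m : ℕ) :
    homogeneousComponent m p = if m = n then p else 0 :=
  homogeneousComponent_of_mem hp

theorem Sq_telescope (j : Fin 5) :
    Sq (X j + X j ^ 2 + X j ^ 4) = X j + X j ^ 8 := by
  have h2 : (2 : P5) = 0 := CharTwo.two_eq_zero
  simp only [map_add, map_pow, Sq_X]
  linear_combination (X j ^ 2 + X j ^ 3 + X j ^ 4 + 2 * X j ^ 5 + 3 * X j ^ 6 + 2 * X j ^ 7) * h2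

/-- `x_j * y ^ 2` is hit when `y` is a product of four variables. -/
theorem isHit_X_mul_sq {ι : Type*} [Fintype ι] (hι : Fintype.card ι = 4) (v : ι → Fin 5)
    (j : Fin 5) : IsHit 9 (X j * (∏ k, X (v k)) ^ 2) := by
  classical
  have hy : (∏ k, (X (v k) : P5)).IsHomogeneous 4 := by
    simpa [hι] using isHomogeneous_prod_X Finset.univ v
  refine ⟨(X j + X j ^ 2 + X j ^ 4) * ∏ k, X (v k), fun m hm => ?_, ?_⟩
  · rw [add_mul, add_mul, map_add, map_add,
      homogeneousComponent_of_isHomogeneous ((isHomogeneous_X _ j).mul hy),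
      homogeneousComponent_of_isHomogeneous (((isHomogeneous_X _ j).pow 2).mul hy),
      homogeneousComponent_of_isHomogeneous (((isHomogeneous_X _ j).pow 4).mul hy),
      if_neg (by omega), if_neg (by omega), if_neg (by omega)]
    simp
  · rw [map_mul, Sq_telescope, Sq_prod_X, Finset.mul_sum, map_sum, Finset.sum_eq_single Finset.univ]
    · have h := hy.mul hy
      rw [add_mul, map_add,
        homogeneousComponent_of_isHomogeneous ((isHomogeneous_X _ j).mul h),
        homogeneousComponent_of_isHomogeneous (((isHomogeneous_X _ j).pow 8).mul h),
        if_pos (by omega), if_neg (by omega)]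
      ring
    · intro t _ ht
      have hc : t.card ≠ 4 := by rwa [← hι, Ne, Finset.card_eq_iff_eq_univ]
      have h := hy.mul (isHomogeneous_prod_X t v)
      rw [add_mul, map_add,
        homogeneousComponent_of_isHomogeneous ((isHomogeneous_X _ j).mul h),
        homogeneousComponent_of_isHomogeneous (((isHomogeneous_X _ j).pow 8).mul h),
        if_neg (by omega), if_neg (by omega), add_zero]
    · simp

/-- `Sq^2` of `x_1 x_2 x_3 x_4 x_5 x_j ^ 2` is hit. -/
theorem isHit_prod_X_mul_pow_four (j : Fin 5) :
    IsHit 9 ((∏ k, X k) * X j ^ 4 +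
      ∑ t : Finset (Fin 5) with t.card = 2, (∏ k, X k) * (∏ k ∈ t, X k) * X j ^ 2) := by
  have hz : (∏ k : Fin 5, (X k : P5)).IsHomogeneous 5 := by
    simpa using isHomogeneous_prod_X Finset.univ id
  refine ⟨(∏ k, X k) * X j ^ 2, fun m hm => ?_, ?_⟩
  · rw [homogeneousComponent_of_isHomogeneous (hz.mul ((isHomogeneous_X _ j).pow 2)),
      if_neg (by omega)]
  · have hS : Sq (∏ k, X k) = ∑ t : Finset (Fin 5), (∏ k, X k) * ∏ k ∈ t, (X k : P5) :=
      Sq_prod_X id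
    have hj : Sq (X j ^ 2) = X j ^ 2 + X j ^ 4 := by
      rw [map_pow, Sq_X, CharTwo.add_sq]
      ring
    have hh (t : Finset (Fin 5)) (n : ℕ) :
        ((∏ k, X k) * (∏ k ∈ t, (X k : P5)) * X j ^ n).IsHomogeneous (5 + t.card + 1 * n) :=
      (hz.mul (isHomogeneous_prod_X t id)).mul ((isHomogeneous_X _ j).pow n)
    rw [map_mul, hS, hj, mul_add, Finset.sum_mul, Finset.sum_mul, map_add, map_sum, map_sum,
      add_comm, Finset.sum_filter]
    refine congr_arg₂ (· + ·) ?_ ?_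
    · refine Finset.sum_congr rfl fun t _ => ?_
      rw [homogeneousComponent_of_isHomogeneous (hh t 2)]
      exact if_congr (by omega) rfl rfl
    · rw [Finset.sum_eq_single ∅]
      · rw [homogeneousComponent_of_isHomogeneous (hh ∅ 4), if_pos (by simp)]
        simp
      · intro t _ ht
        have := Finset.card_pos.2 (Finset.nonempty_iff_ne_empty.2 ht)
        rw [homogeneousComponent_of_isHomogeneous (hh t 4), if_neg (by omega)]
      · simp

theorem monomial_eq_prod_X (d : Fin 5 →₀ ℕ) : (monomial d 1 : P5) = ∏ i, X i ^ d i := by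
  rw [monomial_eq, C_1, one_mul, Finsupp.prod_fintype _ _ (by simp)]

theorem eq_sum_testBit_of_lt {n : ℕ} (hn : n < 16) :
    n = (if n.testBit 0 then 1 else 0) + 2 * (if n.testBit 1 then 1 else 0) +
      4 * (if n.testBit 2 then 1 else 0) + 8 * (if n.testBit 3 then 1 else 0) := by
  revert n
  decide

theorem degree_eq_sum_wt {d : Fin 5 →₀ ℕ} (hd : ∀ j, d j < 16) :
    ∑ j, d j = wt d 0 + 2 * wt d 1 + 4 * wt d 2 + 8 * wt d 3 := by
  simp only [wt, Finset.card_filter, Finset.mul_sum, ← Finset.sum_add_distrib]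
  exact Finset.sum_congr rfl fun j _ => eq_sum_testBit_of_lt (hd j)

theorem wt_eq_zero_of_lt {d : Fin 5 →₀ ℕ} (hd : ∀ j, d j < 16) {i : ℕ} (hi : 4 ≤ i) :
    wt d i = 0 := by
  refine Finset.card_eq_zero.2 (Finset.filter_eq_empty_iff.2 fun j _ => ?_)
  rw [Nat.testBit_lt_two_pow ((hd j).trans_le (Nat.pow_le_pow_right two_pos hi))]
  simp

theorem hasWt_of_forall_lt_four {d : Fin 5 →₀ ℕ} (hd : ∀ j, d j < 16) {w : List ℕ}
    (hw : w.length ≤ 4) (h0 : wt d 0 = w.getD 0 0) (h1 : wt d 1 = w.getD 1 0)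
    (h2 : wt d 2 = w.getD 2 0) (h3 : wt d 3 = w.getD 3 0) : hasWt d w := by
  intro i
  rcases lt_or_ge i 4 with hi | hi
  · interval_cases i <;> assumption
  · rw [wt_eq_zero_of_lt hd hi, List.getD_eq_default _ _ (hw.trans hi)]

/-- The span of the degree-9 monomials of weight vector (3,1,1), (3,3) or (5,2). -/
def admissibleSpan : Submodule (ZMod 2) P5 :=
  Submodule.span (ZMod 2)
    {x : P5 | ∃ d : Fin 5 →₀ ℕ, x = monomial d 1 ∧ (∑ j, d j) = 9 ∧
      (hasWt d [3, 1, 1] ∨ hasWt d [3, 3] ∨ hasWt d [5, 2])}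

theorem lt_sixteen_of_degree_eq_nine {d : Fin 5 →₀ ℕ} (h : ∑ j, d j = 9) (j : Fin 5) :
    d j < 16 := by
  have := Finset.single_le_sum (f := d) (fun _ _ => Nat.zero_le _) (Finset.mem_univ j)
  omega

theorem mem_admissibleSpan_of_wt_zero_eq_three {d : Fin 5 →₀ ℕ} (h : ∑ j, d j = 9)
    (h0 : wt d 0 = 3) : monomial d 1 ∈ admissibleSpan := by
  have hd := lt_sixteen_of_degree_eq_nine h
  have hs := degree_eq_sum_wt hd
  refine Submodule.subset_span ⟨d, rfl, h, ?_⟩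
  obtain h2 | h2 : wt d 2 = 1 ∨ wt d 2 = 0 := by omega
  · exact .inl (hasWt_of_forall_lt_four hd (by simp) h0 (by simp; omega) h2 (by simp; omega))
  · exact .inr (.inl
      (hasWt_of_forall_lt_four hd (by simp) h0 (by simp; omega) h2 (by simp; omega)))

theorem monomial_mem_hitSubmodule_of_wt_zero_eq_one {d : Fin 5 →₀ ℕ} (h : ∑ j, d j = 9)
    (h0 : wt d 0 = 1) : monomial d 1 ∈ hitSubmodule 9 := by
  obtain ⟨j, hj⟩ := Finset.card_eq_one.1 h0
  have hd (i : Fin 5) : d i = (if i = j then 1 else 0) + d i / 2 * 2 := by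
    have hi := Finset.ext_iff.1 hj i
    simp only [Finset.mem_filter, Finset.mem_univ, true_and, Finset.mem_singleton,
      Nat.testBit_zero, decide_eq_true_eq] at hi
    split_ifs with hij
    · have := hi.2 hij
      omega
    · have := mt hi.1 hij
      omega
  have hsum : ∑ i, d i / 2 = 4 := by
    have := Finset.sum_congr rfl fun i (_ : i ∈ Finset.univ) => hd i
    rw [Finset.sum_add_distrib, ← Finset.sum_mul, h, Finset.sum_ite_eq' Finset.univ j,
      if_pos (Finset.mem_univ j)] at this
    omega
  have hm : (monomial d 1 : P5) =
      X j * (∏ k : (i : Fin 5) × Fin (d i / 2), X k.1) ^ 2 := by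
    rw [monomial_eq_prod_X, Fintype.prod_sigma, ← Finset.prod_pow,
      Finset.prod_congr rfl fun i _ => by rw [hd i, pow_add], Finset.prod_mul_distrib]
    simp [pow_mul]
  rw [hm]
  exact isHit_X_mul_sq (by simpa using hsum) _ j

theorem mem_sup_of_all_odd {d : Fin 5 →₀ ℕ} (h : ∑ j, d j = 9) (h0 : wt d 0 = 5)
    (h1 : wt d 1 = 0) (h2 : wt d 2 = 1) (h3 : wt d 3 = 0) :
    monomial d 1 ∈ hitSubmodule 9 ⊔ admissibleSpan := by
  obtain ⟨j, hj⟩ := Finset.card_eq_one.1 h2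
  have hd (i : Fin 5) : d i = 1 + if i = j then 4 else 0 := by
    have hb0 := Finset.filter_card_eq h0 i (Finset.mem_univ i)
    have hb1 := Finset.filter_eq_empty_iff.1 (Finset.card_eq_zero.1 h1) (Finset.mem_univ i)
    have hb2 := Finset.ext_iff.1 hj i
    have hb3 := Finset.filter_eq_empty_iff.1 (Finset.card_eq_zero.1 h3) (Finset.mem_univ i)
    simp only [Finset.mem_filter, Finset.mem_univ, true_and, Finset.mem_singleton] at hb2
    have := eq_sum_testBit_of_lt (lt_sixteen_of_degree_eq_nine h i)
    simpa [hb0, hb1, hb3, hb2] using this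
  have hm : (monomial d 1 : P5) = (∏ k, X k) * X j ^ 4 := by
    rw [monomial_eq_prod_X, Finset.prod_congr rfl fun i _ => by rw [hd i, pow_add],
      Finset.prod_mul_distrib]
    simp [Finset.prod_ite_eq', pow_ite]
  have hrest : ∑ t : Finset (Fin 5) with t.card = 2,
      (∏ k, X k) * (∏ k ∈ t, X k) * X j ^ 2 ∈ admissibleSpan := by
    refine Submodule.sum_mem _ fun t ht => ?_
    rw [Finset.mem_filter] at ht
    let e : Fin 5 →₀ ℕ := Finsupp.equivFunOnFinite.symm fun i =>
      1 + (if i ∈ t then 1 else 0) + if i = j then 2 else 0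
    have he (i : Fin 5) : e i = 1 + (if i ∈ t then 1 else 0) + if i = j then 2 else 0 := rfl
    have hme : (∏ k, X k) * (∏ k ∈ t, X k) * X j ^ 2 = (monomial e 1 : P5) := by
      rw [monomial_eq_prod_X]
      simp only [he, pow_add, Finset.prod_mul_distrib]
      simp [pow_ite, Finset.prod_ite_mem]
    rw [hme]
    refine mem_admissibleSpan_of_wt_zero_eq_three ?_ ?_
    · simp [he, Finset.sum_add_distrib, ht.2]
    · have : (Finset.univ.filter fun i => (e i).testBit 0) = tᶜ := by
        ext i
        simp only [he, Nat.testBit_zero, Finset.mem_filter, Finset.mem_univ, true_and,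
          Finset.mem_compl, decide_eq_true_eq]
        split_ifs <;> simp_all
      rw [wt, this, Finset.card_compl, ht.2, Fintype.card_fin]
  rw [hm]
  have key := Submodule.sub_mem (hitSubmodule 9 ⊔ admissibleSpan)
    (Submodule.mem_sup_left (isHit_prod_X_mul_pow_four j)) (Submodule.mem_sup_right hrest)
  rwa [add_sub_cancel_right] at key

theorem monomial_mem_sup {d : Fin 5 →₀ ℕ} (h : ∑ j, d j = 9) :
    monomial d 1 ∈ hitSubmodule 9 ⊔ admissibleSpan := by
  have hd := lt_sixteen_of_degree_eq_nine h
  have hs := degree_eq_sum_wt hd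
  have hle : wt d 0 ≤ 5 := Finset.card_le_univ _
  obtain h0 | h0 | h0 : wt d 0 = 1 ∨ wt d 0 = 3 ∨ wt d 0 = 5 := by omega
  · exact Submodule.mem_sup_left (monomial_mem_hitSubmodule_of_wt_zero_eq_one h h0)
  · exact Submodule.mem_sup_right (mem_admissibleSpan_of_wt_zero_eq_three h h0)
  · obtain h2 | h2 : wt d 2 = 1 ∨ wt d 2 = 0 := by omega
    · exact mem_sup_of_all_odd h h0 (by omega) h2 (by omega)
    · exact Submodule.mem_sup_right (Submodule.subset_span ⟨d, rfl, h, .inr (.inr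
        (hasWt_of_forall_lt_four hd (by simp) h0 (by simp; omega) h2 (by simp; omega)))⟩)

/-- Every homogeneous polynomial of degree 9 in `P_5` is the sum of a hit polynomial and a
linear combination of monomials of degree 9 of weight vector (3,1,1), (3,3) or (5,2). -/
theorem stmt7 (f : P5) (hf : f ∈ homogeneousSubmodule (Fin 5) (ZMod 2) 9) :
    ∃ h p : P5, IsHit 9 h ∧
      p ∈ Submodule.span (ZMod 2)
        {x : P5 | ∃ d : Fin 5 →₀ ℕ, x = monomial d 1 ∧ (∑ j, d j) = 9 ∧
          (hasWt d [3, 1, 1] ∨ hasWt d [3, 3] ∨ hasWt d [5, 2])} ∧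
      f = h + p := by
  have hmem : f ∈ hitSubmodule 9 ⊔ admissibleSpan := by
    rw [f.as_sum]
    refine Submodule.sum_mem _ fun d hd => ?_
    have hdeg : ∑ j, d j = 9 := by
      rw [← Finsupp.degree_eq_sum, Finsupp.degree_eq_weight_one]
      exact hf (mem_support_iff.1 hd)
    rw [← mul_one (coeff d f), ← smul_eq_mul, ← smul_monomial]
    exact Submodule.smul_mem _ _ (monomial_mem_sup hdeg)
  obtain ⟨h, hh, p, hp, hfp⟩ := Submodule.mem_sup.1 hmem
  exact ⟨h, p, hh, hp, hfp.symm⟩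
end
end

section
/- Every homogeneous polynomial of degree 10 in P_5 can be written as the sum of a hit polynomial and an F_2-linear combination of monomials of degree 10 whose weight vector is (2,2,1,0,...), (2,4,0,0,...), (4,1,1,0,...) or (4,3,0,0,...). -/
open MvPolynomial

noncomputable section

namespace MvPolynomial

variable {σ R : Type*} [CommRing R]

theorem IsHomogeneous.homogeneousComponent_eq_zero {p : MvPolynomial σ R} {k n : ℕ}
    (hp : p.IsHomogeneous k) (hk : k ≠ n) : homogeneousComponent n p = 0 := by
  rw [homogeneousComponent_of_mem hp, if_neg hk.symm]

theorem degree_lt_of_mem_support_mul {p q : MvPolynomial σ R} {a b : ℕ}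
    (hp : p.totalDegree ≤ a) (hq : ∀ d ∈ q.support, d.degree < b) :
    ∀ d ∈ (p * q).support, d.degree < a + b := by
  classical
  intro d hd
  obtain ⟨d₁, h₁, d₂, h₂, rfl⟩ := Finset.mem_add.mp (support_mul p q hd)
  rw [map_add]
  have h := (le_totalDegree h₁).trans hp
  rw [Finsupp.sum, ← Finsupp.degree_apply] at h
  exact add_lt_add_of_le_of_lt h (hq d₂ h₂)

theorem degree_lt_of_mem_support_add {p q : MvPolynomial σ R} {b : ℕ}
    (hp : ∀ d ∈ p.support, d.degree < b) (hq : ∀ d ∈ q.support, d.degree < b) :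
    ∀ d ∈ (p + q).support, d.degree < b := by
  classical
  intro d hd
  rcases Finset.mem_union.mp (support_add hd) with h | h
  exacts [hp d h, hq d h]

theorem IsHomogeneous.degree_lt_of_mem_support {p : MvPolynomial σ R} {k b : ℕ}
    (hp : p.IsHomogeneous k) (hk : k < b) : ∀ d ∈ p.support, d.degree < b := by
  intro d hd
  rw [Finsupp.degree_eq_weight_one]
  exact (hp (mem_support_iff.mp hd)).trans_lt hk

theorem homogeneousComponent_eq_zero_of_degree_lt {p : MvPolynomial σ R} {b m : ℕ}
    (hp : ∀ d ∈ p.support, d.degree < b) (hm : b ≤ m) : homogeneousComponent m p = 0 :=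
  homogeneousComponent_eq_zero' m p fun d hd => ((hp d hd).trans_le hm).ne

end MvPolynomial

theorem IsHit.add {n : ℕ} {f g : P5} (hf : IsHit n f) (hg : IsHit n g) : IsHit n (f + g) := by
  obtain ⟨a, ha, rfl⟩ := hf
  obtain ⟨b, hb, rfl⟩ := hg
  exact ⟨a + b, fun m hm => by rw [map_add, ha m hm, hb m hm, add_zero], by simp only [map_add]⟩

theorem IsHit.smul {n : ℕ} {f : P5} (c : ZMod 2) (hf : IsHit n f) : IsHit n (c • f) := by
  obtain ⟨a, ha, rfl⟩ := hf
  exact ⟨c • a, fun m hm => by rw [map_smul, ha m hm, smul_zero], by simp only [map_smul]⟩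

theorem isHit_zero (n : ℕ) : IsHit n 0 := ⟨0, by simp, by simp⟩

theorem isHit_of_mem_hitSpan {n : ℕ} {f : P5} (hf : f ∈ hitSpan n) : IsHit n f := by
  induction hf using Submodule.span_induction with
  | mem _ h => exact h
  | zero => exact isHit_zero n
  | add _ _ _ _ hx hy => exact hx.add hy
  | smul c _ _ hx => exact hx.smul c

/-- The product of the variables indexed by a multiset. -/
def varProd (s : Multiset (Fin 5)) : P5 := (s.map X).prod

theorem varProd_isHomogeneous (s : Multiset (Fin 5)) :
    (varProd s).IsHomogeneous (Multiset.card s) := by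
  induction s using Multiset.induction with
  | empty => simpa [varProd] using isHomogeneous_one (Fin 5) (ZMod 2)
  | cons i s ih =>
    rw [Multiset.card_cons, add_comm]
    simpa [varProd] using (isHomogeneous_X (ZMod 2) i).mul ih

theorem monomial_eq_varProd (d : Fin 5 →₀ ℕ) :
    (monomial d 1 : P5) = varProd (Finsupp.toMultiset d) := by
  rw [varProd, Finsupp.toMultiset_map, Finsupp.prod_toMultiset, monomial_eq, C_1, one_mul,
    Finsupp.prod_mapDomain_index (by simp) (by simp [pow_add])]

/-- The top component of `Sq p` is `p ^ 2`. -/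
theorem exists_Sq_varProd (s : Multiset (Fin 5)) :
    ∃ r : P5, Sq (varProd s) = varProd s ^ 2 + r ∧
      ∀ d ∈ r.support, d.degree < 2 * Multiset.card s := by
  induction s using Multiset.induction with
  | empty => exact ⟨0, by simp [varProd], by simp⟩
  | cons i s ih =>
    obtain ⟨r, hr, hd⟩ := ih
    have hc : varProd (i ::ₘ s) = X i * varProd s := by simp [varProd]
    refine ⟨X i * varProd s ^ 2 + (X i + X i ^ 2) * r, ?_, ?_⟩
    · rw [hc, map_mul, hr, Sq_X]
      ring
    · rw [Multiset.card_cons]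
      refine degree_lt_of_mem_support_add
        (((isHomogeneous_X _ i).mul ((varProd_isHomogeneous s).pow 2)).degree_lt_of_mem_support
          (by omega)) ?_
      have hX : (X i + X i ^ 2 : P5).totalDegree ≤ 2 :=
        (totalDegree_add _ _).trans (max_le (by simp) (by simp))
      rw [mul_add, mul_one, add_comm (2 * _)]
      exact degree_lt_of_mem_support_mul hX hd

theorem isHit_varProd_sq {s : Multiset (Fin 5)} (hs : 0 < Multiset.card s) :
    IsHit (2 * Multiset.card s) (varProd s ^ 2) := by
  obtain ⟨r, hr, hd⟩ := exists_Sq_varProd s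
  refine ⟨varProd s, fun m hm =>
    (varProd_isHomogeneous s).homogeneousComponent_eq_zero (by omega), ?_⟩
  rw [hr, map_add, homogeneousComponent_eq_zero_of_degree_lt hd le_rfl, add_zero,
    homogeneousComponent_of_mem (by simpa [mul_comm] using (varProd_isHomogeneous s).pow 2),
    if_pos rfl]

/-- Modulo hit polynomials, `x * y * z ^ 4` is the square of `(x * y ^ 2 + x ^ 2 * y) * z`,
by the antipode formula `u * Sq⁴ v ≡ χ(Sq⁴) u * v` with `u = x * y` and `v = z ^ 2`. -/
theorem isHit_mul_mul_pow_four {x y z s : P5} (hx : x.IsHomogeneous 1) (hy : y.IsHomogeneous 1)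
    (hz : z.IsHomogeneous 2) (hs : s.IsHomogeneous 3) (sx : Sq x = x + x ^ 2)
    (sy : Sq y = y + y ^ 2) (sz : Sq z = z + s + z ^ 2) : IsHit 10 (x * y * z ^ 4) := by
  obtain ⟨u, hu⟩ : ∃ u, u = x * y ^ 2 + x ^ 2 * y := ⟨_, rfl⟩
  obtain ⟨t, ht⟩ : ∃ t, t = x * y ^ 4 + x ^ 4 * y := ⟨_, rfl⟩
  obtain ⟨v, hv⟩ : ∃ v, v = x * y ^ 8 + x ^ 8 * y := ⟨_, rfl⟩
  have u3 : u.IsHomogeneous 3 := hu ▸ (hx.mul (hy.pow 2)).add ((hx.pow 2).mul hy)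
  have t5 : t.IsHomogeneous 5 := ht ▸ (hx.mul (hy.pow 4)).add ((hx.pow 4).mul hy)
  have v9 : v.IsHomogeneous 9 := hv ▸ (hx.mul (hy.pow 8)).add ((hx.pow 8).mul hy)
  have xy2 : (x * y).IsHomogeneous 2 := hx.mul hy
  have z4 : (z ^ 2).IsHomogeneous 4 := hz.pow 2
  have s6 : (s ^ 2).IsHomogeneous 6 := hs.pow 2
  have z8 : (z ^ 4).IsHomogeneous 8 := hz.pow 4
  have u6 : (u ^ 2).IsHomogeneous 6 := u3.pow 2
  have t10 : (t ^ 2).IsHomogeneous 10 := t5.pow 2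
  have w8 : ((x * y) ^ 4).IsHomogeneous 8 := xy2.pow 4
  have w4 : ((x * y) ^ 2).IsHomogeneous 4 := xy2.pow 2
  have Sq_u : Sq u = u + t + u ^ 2 := by
    simp only [hu, ht, map_add, map_mul, map_pow, sx, sy]
    grind
  have Sq_t : Sq t = t + u ^ 2 + v + t ^ 2 := by
    simp only [hu, ht, hv, map_add, map_mul, map_pow, sx, sy]
    grind
  have Sq_xy : Sq (x * y) = x * y + u + (x * y) ^ 2 := by
    simp only [hu, map_mul, sx, sy]
    ring
  have zero {p q : P5} {k l : ℕ} (hp : p.IsHomogeneous k) (hq : q.IsHomogeneous l)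
      (h : k + l ≠ 10) : homogeneousComponent 10 (p * q) = 0 :=
    (hp.mul hq).homogeneousComponent_eq_zero h
  refine ⟨x * y * z ^ 2 + u * z ^ 2 + (x * y) ^ 2 * z ^ 2 + t * z ^ 2 + u * z, fun m hm => ?_, ?_⟩
  · simp only [map_add]
    rw [(xy2.mul z4).homogeneousComponent_eq_zero (by omega),
      (u3.mul z4).homogeneousComponent_eq_zero (by omega),
      (w4.mul z4).homogeneousComponent_eq_zero (by omega),
      (t5.mul z4).homogeneousComponent_eq_zero (by omega),
      (u3.mul hz).homogeneousComponent_eq_zero (by omega)]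
    simp
  · obtain ⟨r, hr⟩ : ∃ r, r = x * y * z ^ 2 + x * y * s ^ 2 + u ^ 2 * s ^ 2 + u ^ 2 * z ^ 4 +
        (x * y) ^ 4 * z ^ 2 + (x * y) ^ 4 * s ^ 2 + (x * y) ^ 4 * z ^ 4 + v * z ^ 2 + v * s ^ 2 +
        v * z ^ 4 + t ^ 2 * z ^ 2 + t ^ 2 * s ^ 2 + t ^ 2 * z ^ 4 + u * z + u * s + u * z ^ 2 +
        t * z + t * s + t * z ^ 2 + u ^ 2 * z + u ^ 2 * s := ⟨_, rfl⟩
    have Sq_g : Sq (x * y * z ^ 2 + u * z ^ 2 + (x * y) ^ 2 * z ^ 2 + t * z ^ 2 + u * z) =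
        x * y * z ^ 4 + r := by
      simp only [map_add, map_mul Sq _ (z ^ 2), map_mul Sq u, map_pow, Sq_xy, Sq_u, Sq_t, sz, hr]
      grind
    have r0 : homogeneousComponent 10 r = 0 := by
      simp only [hr, map_add,
        zero xy2 z4 (by omega), zero xy2 s6 (by omega), zero u6 s6 (by omega),
        zero u6 z8 (by omega), zero w8 z4 (by omega), zero w8 s6 (by omega),
        zero w8 z8 (by omega), zero v9 z4 (by omega), zero v9 s6 (by omega),
        zero v9 z8 (by omega), zero t10 z4 (by omega), zero t10 s6 (by omega),
        zero t10 z8 (by omega), zero u3 hz (by omega), zero u3 hs (by omega),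
        zero u3 z4 (by omega), zero t5 hz (by omega), zero t5 hs (by omega),
        zero t5 z4 (by omega), zero u6 hz (by omega), zero u6 hs (by omega), add_zero]
    rw [Sq_g, map_add, r0, add_zero, homogeneousComponent_of_mem (xy2.mul z8), if_pos rfl]

theorem isHit_varProd_mul_pow_four {s t : Multiset (Fin 5)} (hs : Multiset.card s = 2)
    (ht : Multiset.card t = 2) : IsHit 10 (varProd s * varProd t ^ 4) := by
  obtain ⟨i, j, rfl⟩ := Multiset.card_eq_two.mp hs
  obtain ⟨k, l, rfl⟩ := Multiset.card_eq_two.mp ht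
  have hp (i j : Fin 5) : varProd {i, j} = X i * X j := by simp [varProd]
  have hX (i : Fin 5) : (X i : P5).IsHomogeneous 1 := isHomogeneous_X _ i
  rw [hp, hp]
  refine isHit_mul_mul_pow_four (hX i) (hX j) ((hX k).mul (hX l))
    (((hX k).mul ((hX l).pow 2)).add (((hX k).pow 2).mul (hX l))) (Sq_X i) (Sq_X j) ?_
  rw [map_mul, Sq_X, Sq_X]
  ring

theorem wt_eq_sum (d : Fin 5 →₀ ℕ) (i : ℕ) : wt d i = ∑ j, d j / 2 ^ i % 2 := by
  rw [wt, Finset.card_filter]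
  refine Finset.sum_congr rfl fun j _ => ?_
  rw [Nat.testBit_eq_decide_div_mod_eq]
  rcases Nat.mod_two_eq_zero_or_one (d j / 2 ^ i) with h | h <;> simp [h]

theorem hasWt_triple {d : Fin 5 →₀ ℕ} (hd : ∀ j, d j < 8) {a b c : ℕ} (ha : ∑ j, d j % 2 = a)
    (hb : ∑ j, d j / 2 % 2 = b) (hc : ∑ j, d j / 4 = c) : hasWt d [a, b, c] := by
  intro i
  rw [wt_eq_sum]
  match i with
  | 0 => simpa using ha
  | 1 => simpa using hb
  | 2 =>
    simp only [List.getD_cons_succ, List.getD_cons_zero, ← hc]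
    exact Finset.sum_congr rfl fun j _ => by have := hd j; omega
  | i + 3 =>
    refine Finset.sum_eq_zero fun j _ => ?_
    rw [Nat.div_eq_of_lt, Nat.zero_mod]
    calc d j < 2 ^ 3 := hd j
      _ ≤ 2 ^ (i + 3) := Nat.pow_le_pow_right two_pos (by omega)

theorem hasWt_pair {d : Fin 5 →₀ ℕ} {a b : ℕ} (h : hasWt d [a, b, 0]) : hasWt d [a, b] := by
  intro i
  rw [h i]
  match i with
  | 0 | 1 | 2 => rfl
  | i + 3 => rfl

theorem isHit_of_even {d : Fin 5 →₀ ℕ} (hd : ∑ j, d j = 10) (he : ∀ j, d j % 2 = 0) :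
    IsHit 10 (monomial d 1) := by
  obtain ⟨e, rfl⟩ : ∃ e, d = 2 • e :=
    ⟨d.mapRange (· / 2) rfl, by ext j; have := he j; simp; omega⟩
  have hc : Multiset.card (Finsupp.toMultiset e) = 5 := by
    rw [Finsupp.card_toMultiset, Finsupp.sum_fintype _ _ fun _ => rfl]
    simp [← Finset.mul_sum] at hd ⊢
    omega
  have h := isHit_varProd_sq (s := Finsupp.toMultiset e) (by omega)
  rwa [hc, ← monomial_eq_varProd, monomial_pow, one_pow] at h

theorem isHit_of_sum_div_four {d : Fin 5 →₀ ℕ} (hm : ∑ j, d j % 4 = 2)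
    (hq : ∑ j, d j / 4 = 2) : IsHit 10 (monomial d 1) := by
  have hc {e : Fin 5 →₀ ℕ} (he : ∑ j, e j = 2) : Multiset.card (Finsupp.toMultiset e) = 2 := by
    rw [Finsupp.card_toMultiset, Finsupp.sum_fintype _ _ fun _ => rfl]
    exact he
  have hd : d = d.mapRange (· % 4) rfl + 4 • d.mapRange (· / 4) rfl := by
    ext j
    simp
    omega
  have h := isHit_varProd_mul_pow_four (hc (e := d.mapRange (· % 4) rfl) (by simpa using hm))
    (hc (e := d.mapRange (· / 4) rfl) (by simpa using hq))
  rwa [← monomial_eq_varProd, ← monomial_eq_varProd, monomial_pow, monomial_mul, one_pow, one_mul,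
    ← hd] at h

theorem isHit_or_hasWt {d : Fin 5 →₀ ℕ} (hd : ∑ j, d j = 10) : IsHit 10 (monomial d 1) ∨
    hasWt d [2, 2, 1] ∨ hasWt d [2, 4] ∨ hasWt d [4, 1, 1] ∨ hasWt d [4, 3] := by
  by_cases he : ∀ j, d j % 2 = 0
  · exact .inl (isHit_of_even hd he)
  obtain ⟨a, ha⟩ : ∃ a, ∑ j, d j % 2 = a := ⟨_, rfl⟩
  obtain ⟨b, hb⟩ : ∃ b, ∑ j, d j / 2 % 2 = b := ⟨_, rfl⟩
  obtain ⟨c, hc⟩ : ∃ c, ∑ j, d j / 4 = c := ⟨_, rfl⟩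
  have habc : a + 2 * b + 4 * c = 10 := by
    rw [← ha, ← hb, ← hc, ← hd]
    simp only [Finset.mul_sum, ← Finset.sum_add_distrib]
    exact Finset.sum_congr rfl fun j _ => by omega
  have a0 : a ≠ 0 := fun h => he fun j =>
    Finset.sum_eq_zero_iff.mp (ha.trans h) j (Finset.mem_univ j)
  have a5 : a ≤ 5 := by
    rw [← ha]
    exact (Finset.sum_le_card_nsmul _ _ 1 fun j _ => by omega).trans (by simp)
  have b5 : b ≤ 5 := by
    rw [← hb]
    exact (Finset.sum_le_card_nsmul _ _ 1 fun j _ => by omega).trans (by simp)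
  by_cases c2 : c = 2
  · refine .inl (isHit_of_sum_div_four ?_ (hc.trans c2))
    have : ∑ j, d j % 4 + 4 * ∑ j, d j / 4 = 10 := by
      rw [← hd, Finset.mul_sum, ← Finset.sum_add_distrib]
      exact Finset.sum_congr rfl fun j _ => by omega
    omega
  have d8 (j : Fin 5) : d j < 8 := by
    have := Finset.single_le_sum (f := fun j => d j / 4) (fun _ _ => Nat.zero_le _)
      (Finset.mem_univ j)
    rw [hc] at this
    omega
  have h := hasWt_triple d8 ha hb hc
  have : a = 2 ∧ b = 2 ∧ c = 1 ∨ a = 2 ∧ b = 4 ∧ c = 0 ∨ a = 4 ∧ b = 1 ∧ c = 1 ∨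
      a = 4 ∧ b = 3 ∧ c = 0 := by omega
  rcases this with ⟨rfl, rfl, rfl⟩ | ⟨rfl, rfl, rfl⟩ | ⟨rfl, rfl, rfl⟩ | ⟨rfl, rfl, rfl⟩
  exacts [.inr (.inl h), .inr (.inr (.inl (hasWt_pair h))), .inr (.inr (.inr (.inl h))),
    .inr (.inr (.inr (.inr (hasWt_pair h))))]

/-- Every homogeneous polynomial of degree 10 in `P_5` is the sum of a hit polynomial and a
linear combination of monomials of degree 10 of weight vector (2,2,1), (2,4), (4,1,1) or (4,3). -/
theorem stmt8 (f : P5) (hf : f ∈ homogeneousSubmodule (Fin 5) (ZMod 2) 10) :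
    ∃ h p : P5, IsHit 10 h ∧
      p ∈ Submodule.span (ZMod 2)
        {x : P5 | ∃ d : Fin 5 →₀ ℕ, x = monomial d 1 ∧ (∑ j, d j) = 10 ∧
          (hasWt d [2, 2, 1] ∨ hasWt d [2, 4] ∨ hasWt d [4, 1, 1] ∨ hasWt d [4, 3])} ∧
      f = h + p := by
  suffices h : f ∈ hitSpan 10 ⊔ Submodule.span (ZMod 2)
      {x : P5 | ∃ d : Fin 5 →₀ ℕ, x = monomial d 1 ∧ (∑ j, d j) = 10 ∧
        (hasWt d [2, 2, 1] ∨ hasWt d [2, 4] ∨ hasWt d [4, 1, 1] ∨ hasWt d [4, 3])} by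
    obtain ⟨g, hh, p, hp, rfl⟩ := Submodule.mem_sup.mp h
    exact ⟨g, p, isHit_of_mem_hitSpan hh, hp, rfl⟩
  rw [f.as_sum]
  refine sum_mem fun d hd => ?_
  have hdeg : ∑ j, d j = 10 := by
    rw [← Finsupp.degree_eq_sum, Finsupp.degree_eq_weight_one]
    exact hf (mem_support_iff.mp hd)
  rw [← mul_one (coeff d f), ← smul_eq_mul, ← smul_monomial]
  refine Submodule.smul_mem _ _ ?_
  rcases isHit_or_hasWt hdeg with h | h
  · exact Submodule.mem_sup_left (Submodule.subset_span h)
  · exact Submodule.mem_sup_right (Submodule.subset_span ⟨d, rfl, hdeg, h⟩)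
end
end

section
/- The F_2-vector space (QP_5)_10 has dimension 280, i.e., the space of homogeneous polynomials of degree 10 in P_5 modulo hit polynomials has dimension 280 over F_2. -/
open MvPolynomial

noncomputable section

/-- The degrees of the leading terms of `kronecker (X i)`. -/
def leadWeight : Fin 5 → ℕ := ![1, 2, 12, 122, 1332]

/-- The code of `kronecker (X i) * f`, where `f` has code `a`. -/
def mulVarCode (i : Fin 5) (a : ℕ) : ℕ := (a <<< leadWeight i) ^^^ (a <<< (i : ℕ))

/-- The code of the image under `kronecker` of the elementary symmetric polynomial of degree `j` in
the letters of `s`. -/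
def esymmCode : List (Fin 5) → ℕ → ℕ
  | _, 0 => 1
  | [], _ + 1 => 0
  | i :: s, j + 1 => esymmCode s (j + 1) ^^^ mulVarCode i (esymmCode s j)

/-- The code of the image under `kronecker` of the degree-`n` component of `Sq x`, where `x` is the
product of the letters of `s`. -/
def hitCode (n : ℕ) (s : List (Fin 5)) : ℕ :=
  s.foldr mulVarCode (esymmCode s (n - s.length))

/-- The sorted words of length at most `n` whose set of letters is that of `S`. -/
def wordsOfSupport : List (Fin 5) → ℕ → List (List (Fin 5))
  | [], _ => [[]]
  | i :: S, n => (List.range n).flatMap fun k =>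
      (wordsOfSupport S (n - (k + 1))).map (List.replicate (k + 1) i ++ ·)

/-- Gaussian elimination over `F_2` on the first `n` of the given bit vectors. -/
def xorBasis : ℕ → List ℕ → List ℕ
  | 0, L => L
  | _ + 1, [] => []
  | n + 1, v :: L =>
      bif v == 0 then xorBasis n L else v :: xorBasis n (L.map fun x => min x (x ^^^ v))

/-- The position of the leading bit of a number below `2 ^ 2 ^ s`, by bisection. -/
def leadIndex : ℕ → ℕ → ℕ
  | 0, _ => 0
  | s + 1, b => bif b >>> 2 ^ s == 0 then leadIndex s b else 2 ^ s + leadIndex s (b >>> 2 ^ s)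

/-- Checks that the leading bits of the given numbers are distinct, and not among those of `m`. -/
def leadsDistinct : List ℕ → ℕ → Bool
  | [], _ => true
  | b :: B, m =>
      b >>> leadIndex 14 b == 1 && !m.testBit (leadIndex 14 b) &&
        leadsDistinct B (m ||| 1 <<< leadIndex 14 b)

/-- Codes of a basis of the image of `hitSpan 10` under `kronecker`. -/
def hitBasis : List ℕ :=
  (List.finRange 5).sublists.flatMap fun S => xorBasis 126 ((wordsOfSupport S 9).map (hitCode 10))

/-- The polynomial over `F_2` whose coefficients are the binary digits of `n`. -/
def bitPoly (n : ℕ) : Polynomial (ZMod 2) :=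
  ∑ k ∈ Finset.range n with n.testBit k, Polynomial.X ^ k

lemma coeff_bitPoly (n k : ℕ) : (bitPoly n).coeff k = if n.testBit k then 1 else 0 := by
  have h : n.testBit k = true → k < n := fun h =>
    k.lt_two_pow_self.trans_le (Nat.ge_two_pow_of_testBit h)
  simp [bitPoly, Polynomial.coeff_X_pow, and_iff_right_of_imp h]

lemma bitPoly_zero : bitPoly 0 = 0 := by simp [bitPoly]

lemma bitPoly_one : bitPoly 1 = 1 := by
  simp [bitPoly, Finset.sum_filter]

lemma bitPoly_xor (a b : ℕ) : bitPoly (a ^^^ b) = bitPoly a + bitPoly b := by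
  ext k
  simp only [coeff_bitPoly, Nat.testBit_xor, Polynomial.coeff_add]
  cases a.testBit k <;> cases b.testBit k <;> decide

lemma bitPoly_shiftLeft (a k : ℕ) : bitPoly (a <<< k) = Polynomial.X ^ k * bitPoly a := by
  ext j
  by_cases h : k ≤ j <;>
    simp [coeff_bitPoly, Nat.testBit_shiftLeft, Polynomial.coeff_X_pow_mul', h]

lemma natDegree_bitPoly {n : ℕ} (hn : n ≠ 0) : (bitPoly n).natDegree = n.log2 := by
  refine Polynomial.natDegree_eq_of_le_of_coeff_ne_zero ?_ ?_
  · refine Polynomial.natDegree_le_iff_coeff_eq_zero.2 fun k hk => ?_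
    rw [coeff_bitPoly, Nat.testBit_lt_two_pow ((Nat.log2_lt hn).1 hk)]
    rfl
  · simp [coeff_bitPoly, Nat.testBit_log2 hn]

lemma bitPoly_ne_zero {n : ℕ} (hn : n ≠ 0) : bitPoly n ≠ 0 := fun h => by
  have := coeff_bitPoly n n.log2
  simp [h, Nat.testBit_log2 hn] at this

lemma linearIndependent_of_natDegree_injective {K ι : Type*} [Field K] {v : ι → Polynomial K}
    (hv : ∀ i, v i ≠ 0) (hdeg : Function.Injective fun i => (v i).natDegree) :
    LinearIndependent K v := by
  refine linearIndependent_iff'.2 fun s c hc i hi => ?_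
  have h := Polynomial.degree_sum_eq_of_disjoint (fun i => c i • v i) s ?_
  · rw [hc, Polynomial.degree_zero, eq_comm, Finset.sup_eq_bot_iff] at h
    simpa [hv i] using h i hi
  · rintro i ⟨-, hi⟩ j ⟨-, hj⟩ hij h
    have hi' : c i ≠ 0 := left_ne_zero_of_smul hi
    have hj' : c j ≠ 0 := left_ne_zero_of_smul hj
    refine hij (hdeg ?_)
    simpa [Polynomial.natDegree_smul _ hi', Polynomial.natDegree_smul _ hj'] using
      Polynomial.natDegree_eq_of_degree_eq h

/-- The span of the polynomials coded by the members of `L`. -/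
def codeSpan (L : List ℕ) : Submodule (ZMod 2) (Polynomial (ZMod 2)) :=
  Submodule.span (ZMod 2) (bitPoly '' {a | a ∈ L})

lemma codeSpan_le {L : List ℕ} {V : Submodule (ZMod 2) (Polynomial (ZMod 2))} :
    codeSpan L ≤ V ↔ ∀ a ∈ L, bitPoly a ∈ V := by
  simp [codeSpan, Submodule.span_le, Set.subset_def]

lemma bitPoly_mem_codeSpan {L : List ℕ} {a : ℕ} (ha : a ∈ L) : bitPoly a ∈ codeSpan L :=
  codeSpan_le.1 le_rfl a ha

lemma codeSpan_cons (a : ℕ) (L : List ℕ) :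
    codeSpan (a :: L) = codeSpan [a] ⊔ codeSpan L := by
  refine le_antisymm (codeSpan_le.2 ?_) (sup_le ?_ ?_)
  · rintro b (- | ⟨_, hb⟩)
    · exact Submodule.mem_sup_left (bitPoly_mem_codeSpan (by simp))
    · exact Submodule.mem_sup_right (bitPoly_mem_codeSpan hb)
  all_goals exact codeSpan_le.2 fun b hb => bitPoly_mem_codeSpan (by simp_all)

lemma codeSpan_flatMap_congr {α : Type*} {f g : α → List ℕ} (L : List α)
    (h : ∀ a ∈ L, codeSpan (f a) = codeSpan (g a)) :
    codeSpan (L.flatMap f) = codeSpan (L.flatMap g) := by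
  have key : ∀ f g : α → List ℕ, (∀ a ∈ L, codeSpan (f a) = codeSpan (g a)) →
      codeSpan (L.flatMap f) ≤ codeSpan (L.flatMap g) := fun f g h => by
    refine codeSpan_le.2 fun b hb => ?_
    obtain ⟨a, ha, hb⟩ := List.mem_flatMap.1 hb
    refine (h a ha ▸ codeSpan_le.2 fun c hc => ?_ : codeSpan (f a) ≤ _) (bitPoly_mem_codeSpan hb)
    exact bitPoly_mem_codeSpan (List.mem_flatMap.2 ⟨a, ha, hc⟩)
  exact le_antisymm (key f g h) (key g f fun a ha => (h a ha).symm)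

lemma codeSpan_cons_map_min_xor (v : ℕ) (L : List ℕ) :
    codeSpan (v :: L.map fun x => min x (x ^^^ v)) = codeSpan (v :: L) := by
  have key : ∀ x, bitPoly (min x (x ^^^ v)) = bitPoly x ∨
      bitPoly (min x (x ^^^ v)) = bitPoly x + bitPoly v := fun x => by
    rw [← bitPoly_xor]
    exact (min_choice x (x ^^^ v)).imp (congrArg _) (congrArg _)
  refine le_antisymm (codeSpan_le.2 ?_) (codeSpan_le.2 ?_) <;> rintro b (- | ⟨_, hb⟩)
  · exact bitPoly_mem_codeSpan (by simp)
  · obtain ⟨x, hx, rfl⟩ := List.mem_map.1 hb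
    have hx' : bitPoly x ∈ codeSpan (v :: L) := bitPoly_mem_codeSpan (by simp [hx])
    rcases key x with h | h <;> rw [h]
    · exact hx'
    · exact add_mem hx' (bitPoly_mem_codeSpan (by simp))
  · exact bitPoly_mem_codeSpan (by simp)
  · have hv : bitPoly v ∈ codeSpan (v :: L.map fun x => min x (x ^^^ v)) :=
      bitPoly_mem_codeSpan (by simp)
    have hb' : bitPoly (min b (b ^^^ v)) ∈ codeSpan (v :: L.map fun x => min x (x ^^^ v)) :=
      bitPoly_mem_codeSpan (List.mem_cons_of_mem _ (List.mem_map_of_mem hb))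
    rcases key b with h | h <;> rw [h] at hb'
    · exact hb'
    · exact (Submodule.add_mem_iff_left _ hv).1 hb'

lemma codeSpan_xorBasis (n : ℕ) (L : List ℕ) : codeSpan (xorBasis n L) = codeSpan L := by
  induction n generalizing L with
  | zero => rfl
  | succ n ih =>
    cases L with
    | nil => rfl
    | cons v L =>
      rw [xorBasis, cond_eq_ite]
      split_ifs with hv
      · rw [ih, codeSpan_cons v, eq_of_beq hv, eq_comm]
        exact sup_eq_right.2 (codeSpan_le.2 (by simp [bitPoly_zero]))
      · rw [codeSpan_cons, ih, ← codeSpan_cons, codeSpan_cons_map_min_xor]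

lemma nodup_log2_of_leadsDistinct (B : List ℕ) (m : ℕ) (h : leadsDistinct B m = true) :
    (B.map Nat.log2).Nodup ∧ ∀ b ∈ B, b ≠ 0 ∧ m.testBit b.log2 = false := by
  induction B generalizing m with
  | nil => simp
  | cons b B ih =>
    simp only [leadsDistinct, Bool.and_eq_true, Bool.not_eq_true', beq_iff_eq] at h
    obtain ⟨⟨hb, hm⟩, hB⟩ := h
    have hb0 : b ≠ 0 := by rintro rfl; simp at hb
    have hlog : b.log2 = leadIndex 14 b := by
      rw [Nat.log2_eq_iff hb0]
      rw [Nat.shiftRight_eq_div_pow, Nat.div_eq_iff (by positivity)] at hb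
      rw [pow_succ]
      omega
    rw [← hlog] at hm hB
    obtain ⟨hnodup, hmem⟩ := ih _ hB
    have hmem' : ∀ a ∈ B, m.testBit a.log2 = false ∧ b.log2 ≠ a.log2 := fun a ha => by
      have h := (hmem a ha).2
      rw [Nat.testBit_or, Bool.or_eq_false_iff, Nat.one_shiftLeft, Nat.testBit_two_pow] at h
      simpa using h
    refine ⟨?_, ?_⟩
    · rw [List.map_cons, List.nodup_cons]
      refine ⟨fun h => ?_, hnodup⟩
      obtain ⟨a, ha, hab⟩ := List.mem_map.1 h
      exact (hmem' a ha).2 hab.symm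
    · rintro a (- | ⟨_, ha⟩)
      · exact ⟨hb0, hm⟩
      · exact ⟨(hmem a ha).1, (hmem' a ha).1⟩

lemma finrank_codeSpan_of_leadsDistinct {B : List ℕ} (h : leadsDistinct B 0 = true) :
    Module.finrank (ZMod 2) (codeSpan B) = B.length := by
  obtain ⟨hnodup, hmem⟩ := nodup_log2_of_leadsDistinct B 0 h
  have hne : ∀ i : Fin B.length, B.get i ≠ 0 := fun i => (hmem _ (B.get_mem i)).1
  have hli : LinearIndependent (ZMod 2) fun i : Fin B.length => bitPoly (B.get i) := by
    refine linearIndependent_of_natDegree_injective (fun i => bitPoly_ne_zero (hne i)) ?_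
    intro i j hij
    simp only [natDegree_bitPoly (hne _)] at hij
    exact Fin.ext ((hnodup.getElem_inj_iff (hi := by simp) (hj := by simp)).1 (by simpa using hij))
  have hrange : Set.range (fun i : Fin B.length => bitPoly (B.get i)) = bitPoly '' {a | a ∈ B} := by
    rw [← Set.range_list_get, ← Set.range_comp]
    rfl
  rw [codeSpan, ← hrange, finrank_span_eq_card hli, Fintype.card_fin]

/-- The algebra homomorphism into `F_2[T]` whose values on monomials of a given degree have distinct
degrees. The lower terms are there for speed only: the kernel hashes a number by its low bits, which
would otherwise agree for most of the codes. -/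
def kronecker : P5 →ₐ[ZMod 2] Polynomial (ZMod 2) :=
  aeval fun i => Polynomial.X ^ leadWeight i + Polynomial.X ^ (i : ℕ)

lemma bitPoly_mulVarCode (i : Fin 5) (a : ℕ) :
    bitPoly (mulVarCode i a) = kronecker (X i) * bitPoly a := by
  simp [mulVarCode, kronecker, bitPoly_xor, bitPoly_shiftLeft, add_mul]

lemma MvPolynomial.IsHomogeneous.homogeneousComponent_mul {σ R : Type*} [CommSemiring R]
    {p : MvPolynomial σ R} {m : ℕ} (hp : p.IsHomogeneous m) (n : ℕ) (f : MvPolynomial σ R) :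
    homogeneousComponent (m + n) (p * f) = p * homogeneousComponent n f := by
  let : GradedRing (homogeneousSubmodule σ R) := gradedAlgebra
  have := DirectSum.coe_decompose_mul_add_of_left_mem (homogeneousSubmodule σ R) (b := f) (j := n)
    ((mem_homogeneousSubmodule m p).2 hp)
  rw [← decomposition.decompose'_apply, ← decomposition.decompose'_apply]
  exact this

lemma bitPoly_esymmCode (s : List (Fin 5)) (j : ℕ) :
    bitPoly (esymmCode s j) =
      kronecker (homogeneousComponent j (s.map fun i => 1 + X i : List P5).prod) := by
  induction s generalizing j with
  | nil =>
    cases j with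
    | zero => simp [esymmCode, bitPoly_one, homogeneousComponent_zero]
    | succ j =>
      rw [List.map_nil, List.prod_nil, homogeneousComponent_eq_zero _ _ (by simp), map_zero]
      exact bitPoly_zero
  | cons i s ih =>
    cases j with
    | zero =>
      have h : ∀ s : List (Fin 5), constantCoeff (s.map fun i => 1 + X i : List P5).prod = 1 :=
        fun s => by simp [map_list_prod, Function.comp_def]
      rw [homogeneousComponent_zero, ← constantCoeff_eq, h]
      simp [esymmCode, bitPoly_one]
    | succ j =>
      have h := (isHomogeneous_X (ZMod 2) i).homogeneousComponent_mul j
        (s.map fun i => 1 + X i : List P5).prod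
      rw [add_comm 1 j] at h
      rw [esymmCode, bitPoly_xor, bitPoly_mulVarCode, ih, ih, List.map_cons, List.prod_cons,
        add_mul, one_mul, map_add, h, map_add, map_mul]

/-- The monomial that is the product of the letters of `s`. -/
def wordMonomial (s : List (Fin 5)) : P5 := (s.map X).prod

lemma isHomogeneous_wordMonomial (s : List (Fin 5)) :
    (wordMonomial s).IsHomogeneous s.length := by
  induction s with
  | nil => exact isHomogeneous_one _ _
  | cons i s ih =>
    rw [wordMonomial, List.map_cons, List.prod_cons, List.length_cons, add_comm]
    exact (isHomogeneous_X _ i).mul ih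

lemma Sq_wordMonomial (s : List (Fin 5)) :
    Sq (wordMonomial s) = wordMonomial s * (s.map fun i => 1 + X i : List P5).prod := by
  rw [wordMonomial, ← List.prod_map_mul, map_list_prod, List.map_map]
  congr 2
  ext1 i
  simp only [Function.comp_apply, Sq, aeval_X]
  ring

lemma bitPoly_hitCode {n : ℕ} {s : List (Fin 5)} (hs : s.length ≤ n) :
    bitPoly (hitCode n s) = kronecker (homogeneousComponent n (Sq (wordMonomial s))) := by
  have h := (isHomogeneous_wordMonomial s).homogeneousComponent_mul (n - s.length)
    (s.map fun i => 1 + X i : List P5).prod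
  rw [Nat.add_sub_cancel' hs] at h
  rw [Sq_wordMonomial, h, map_mul, ← bitPoly_esymmCode, hitCode]
  generalize esymmCode s (n - s.length) = a
  clear hs h
  induction s with
  | nil => simp [wordMonomial]
  | cons i s ih =>
    rw [List.foldr_cons, bitPoly_mulVarCode, ih, wordMonomial, wordMonomial, List.map_cons,
      List.prod_cons, map_mul, mul_assoc]

lemma length_le_of_mem_wordsOfSupport {S : List (Fin 5)} {n : ℕ} {s : List (Fin 5)}
    (hs : s ∈ wordsOfSupport S n) : s.length ≤ n := by
  induction S generalizing n s with
  | nil => simp_all [wordsOfSupport]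
  | cons i S ih =>
    simp only [wordsOfSupport, List.mem_flatMap, List.mem_range, List.mem_map] at hs
    obtain ⟨k, hk, t, ht, rfl⟩ := hs
    have := ih ht
    simp
    omega

lemma flatMap_replicate_mem_wordsOfSupport {d : Fin 5 → ℕ} {S : List (Fin 5)} {n : ℕ}
    (hd : ∀ i ∈ S, d i ≠ 0) (hn : (S.map d).sum ≤ n) :
    (S.flatMap fun i => List.replicate (d i) i) ∈ wordsOfSupport S n := by
  induction S generalizing n with
  | nil => simp [wordsOfSupport]
  | cons i S ih =>
    rw [List.map_cons, List.sum_cons] at hn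
    have hi : d i - 1 + 1 = d i := Nat.succ_pred (hd i (by simp))
    simp only [wordsOfSupport, List.mem_flatMap, List.mem_range, List.mem_map]
    refine ⟨d i - 1, by omega, _, ih (fun j hj => hd j (by simp [hj])) (by omega), ?_⟩
    rw [hi, List.flatMap_cons]

lemma exists_wordMonomial_eq_monomial {d : Fin 5 →₀ ℕ} {n : ℕ} (hd : d.degree ≤ n) :
    ∃ S ∈ (List.finRange 5).sublists, ∃ s ∈ wordsOfSupport S n,
      wordMonomial s = monomial d 1 := by
  set S := (List.finRange 5).filter fun i => d i ≠ 0 with hS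
  have hmem : ∀ i, i ∈ S ↔ i ∈ d.support := by simp [hS]
  have hnodup : S.Nodup := (List.nodup_finRange 5).filter _
  have hfin : S.toFinset = d.support := by ext i; simp [hmem]
  refine ⟨S, List.mem_sublists.2 List.filter_sublist, S.flatMap fun i => List.replicate (d i) i,
    flatMap_replicate_mem_wordsOfSupport (by simp [hS]) ?_, ?_⟩
  · rwa [← List.sum_toFinset _ hnodup, hfin]
  · rw [monomial_eq, C_1, one_mul, Finsupp.prod, ← hfin, List.prod_toFinset _ hnodup, wordMonomial]
    generalize S = T
    induction T with
    | nil => simp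
    | cons i T ih => simp [ih]

lemma hitSpan_eq_span_words (n : ℕ) : hitSpan (n + 1) = Submodule.span (ZMod 2)
    ((fun s => homogeneousComponent (n + 1) (Sq (wordMonomial s))) ''
      {s | s ∈ (List.finRange 5).sublists.flatMap fun S => wordsOfSupport S n}) := by
  refine le_antisymm (Submodule.span_le.2 ?_) (Submodule.span_mono ?_)
  · rintro f ⟨g, hg, rfl⟩
    rw [g.as_sum, map_sum, map_sum]
    refine Submodule.sum_mem _ fun d hd => ?_
    have hdeg : d.degree ≤ n := by
      by_contra! h
      have := congrArg (coeff d) (hg d.degree h)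
      rw [coeff_homogeneousComponent, if_pos rfl, coeff_zero] at this
      exact mem_support_iff.1 hd this
    obtain ⟨S, hS, s, hs, h⟩ := exists_wordMonomial_eq_monomial hdeg
    have hsmul : monomial d (coeff d g) = coeff d g • wordMonomial s := by
      rw [h, smul_monomial, smul_eq_mul, mul_one]
    rw [hsmul, map_smul, map_smul]
    exact Submodule.smul_mem _ _
      (Submodule.subset_span ⟨s, List.mem_flatMap.2 ⟨S, hS, hs⟩, rfl⟩)
  · rintro _ ⟨s, hs, rfl⟩
    obtain ⟨S, -, hs⟩ := List.mem_flatMap.1 hs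
    refine ⟨wordMonomial s, fun m hm => ?_, rfl⟩
    have := length_le_of_mem_wordsOfSupport hs
    rw [homogeneousComponent_of_mem (isHomogeneous_wordMonomial s), if_neg (by omega)]

lemma map_kronecker_hitSpan :
    (hitSpan 10).map kronecker.toLinearMap = codeSpan hitBasis := by
  rw [hitBasis, codeSpan_flatMap_congr _ fun S _ => codeSpan_xorBasis 126 _,
    ← List.map_flatMap, hitSpan_eq_span_words, Submodule.map_span, codeSpan, ← Set.image_comp]
  congr 1
  ext p
  simp only [Set.mem_image, Set.mem_ofPred_eq, List.mem_map, exists_exists_and_eq_and]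
  refine exists_congr fun s => and_congr_right fun hs => ?_
  obtain ⟨S, -, hs⟩ := List.mem_flatMap.1 hs
  rw [bitPoly_hitCode ((length_le_of_mem_wordsOfSupport hs).trans (Nat.le_succ 9))]
  rfl

lemma natDegree_kronecker_monomial (d : Fin 5 →₀ ℕ) :
    kronecker (monomial d 1) ≠ 0 ∧
      (kronecker (monomial d 1)).natDegree = ∑ i, d i * leadWeight i := by
  have hlt : ∀ i : Fin 5, (i : ℕ) < leadWeight i := by decide
  have hdeg : ∀ i : Fin 5, (Polynomial.X ^ (i : ℕ) : Polynomial (ZMod 2)).degree <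
      (leadWeight i : ℕ) := fun i => by simpa using hlt i
  have hmonic : ∀ i : Fin 5,
      (Polynomial.X ^ leadWeight i + Polynomial.X ^ (i : ℕ) : Polynomial (ZMod 2)).Monic :=
    fun i => Polynomial.monic_X_pow_add (hdeg i)
  have hnat : ∀ i : Fin 5, (Polynomial.X ^ leadWeight i + Polynomial.X ^ (i : ℕ) :
      Polynomial (ZMod 2)).natDegree = leadWeight i := fun i => by
    rw [Polynomial.natDegree_add_eq_left_of_natDegree_lt] <;> simp [hlt]
  have heq : kronecker (monomial d 1) =
      ∏ i, (Polynomial.X ^ leadWeight i + Polynomial.X ^ (i : ℕ)) ^ d i := by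
    rw [kronecker, aeval_monomial, map_one, one_mul, Finsupp.prod_fintype _ _ (by simp)]
  rw [heq]
  refine ⟨(Polynomial.monic_prod_of_monic _ _ fun i _ => (hmonic i).pow _).ne_zero, ?_⟩
  rw [Polynomial.natDegree_prod_of_monic _ _ fun i _ => (hmonic i).pow _]
  exact Finset.sum_congr rfl fun i _ => by rw [(hmonic i).natDegree_pow, hnat]

lemma injective_kronecker_domRestrict : Function.Injective
    (kronecker.toLinearMap.domRestrict (homogeneousSubmodule (Fin 5) (ZMod 2) 10)) := by
  rw [homogeneousSubmodule_eq_finsupp_supported]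
  change Function.Injective
    (kronecker.toLinearMap.domRestrict (restrictSupport (ZMod 2) {d : Fin 5 →₀ ℕ | d.degree = 10}))
  let b := basisRestrictSupport (ZMod 2) {d : Fin 5 →₀ ℕ | d.degree = 10}
  have hb : ∀ d, (b d : P5) = monomial d.1 1 := fun d =>
    congrArg AddMonoidAlgebra.ofCoeff (Finsupp.supportedEquivFinsupp_symm_single _ d 1)
  have hkb : ∀ d, kronecker.toLinearMap.domRestrict _ (b d) = kronecker (monomial d.1 1) :=
    fun d => congrArg kronecker (hb d)
  refine LinearMap.injective_of_linearIndependent (v := b) b.span_eq ?_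
  refine linearIndependent_of_natDegree_injective (fun d => ?_) fun d e hde => ?_
  · rw [Function.comp_apply, hkb]
    exact (natDegree_kronecker_monomial d.1).1
  · have hde' : ∑ i, d.1 i * leadWeight i = ∑ i, e.1 i * leadWeight i := by
      simpa only [Function.comp_apply, hkb, (natDegree_kronecker_monomial _).2] using hde
    have hd : ∑ i, d.1 i = 10 := by rw [← Finsupp.degree_eq_sum]; exact d.2
    have he : ∑ i, e.1 i = 10 := by rw [← Finsupp.degree_eq_sum]; exact e.2
    rw [Fin.sum_univ_five] at hd he
    simp only [leadWeight, Fin.sum_univ_five, Matrix.cons_val] at hde'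
    have h4 : d.1 4 = e.1 4 := by omega
    have h3 : d.1 3 = e.1 3 := by omega
    have h2 : d.1 2 = e.1 2 := by omega
    refine Subtype.ext (Finsupp.ext fun i => ?_)
    fin_cases i <;> simp <;> omega

lemma finrank_homogeneousSubmodule (σ R : Type*) [Fintype σ] [CommRing R] [Nontrivial R] (n : ℕ) :
    Module.finrank R (homogeneousSubmodule σ R n) = (Fintype.card σ + n - 1).choose n := by
  classical
  have hset : {d : σ →₀ ℕ | d.degree = n} = (Finset.univ : Finset σ).finsuppAntidiag n := by
    ext d
    simp [Finsupp.degree_eq_sum]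
  rw [homogeneousSubmodule_eq_finsupp_supported]
  refine (Module.finrank_eq_nat_card_basis (basisRestrictSupport R _)).trans ?_
  rw [hset, Nat.card_coe_set_eq, Set.ncard_coe_finset, Finset.card_finsuppAntidiag_nat_eq_choose,
    Finset.card_univ]

lemma hitSpan_le_homogeneousSubmodule (n : ℕ) :
    hitSpan n ≤ homogeneousSubmodule (Fin 5) (ZMod 2) n := by
  refine Submodule.span_le.2 ?_
  rintro _ ⟨g, -, rfl⟩
  exact homogeneousComponent_mem n _

set_option maxRecDepth 10000 in
lemma leadsDistinct_hitBasis_and_length :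
    leadsDistinct hitBasis 0 = true ∧ hitBasis.length = 721 := by
  decide +kernel

/-- `dim_{F_2} (QP_5)_10 = 280`. -/
theorem stmt9 :
    Module.finrank (ZMod 2)
      (↥(homogeneousSubmodule (Fin 5) (ZMod 2) 10) ⧸
        Submodule.comap (homogeneousSubmodule (Fin 5) (ZMod 2) 10).subtype (hitSpan 10)) = 280 := by
  set H := homogeneousSubmodule (Fin 5) (ZMod 2) 10
  have : Module.Finite (ZMod 2) H := Module.Finite.iff_fg.2 (homogeneousSubmodule_fg _ _ 10)
  have hH : Module.finrank (ZMod 2) H = 1001 := finrank_homogeneousSubmodule _ _ 10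
  have hhit : Module.finrank (ZMod 2) ((hitSpan 10).comap H.subtype) = 721 := by
    have hmap : ((hitSpan 10).comap H.subtype).map (kronecker.toLinearMap.domRestrict H) =
        codeSpan hitBasis := by
      rw [LinearMap.domRestrict, Submodule.map_comp, Submodule.map_comap_subtype,
        inf_eq_right.2 (hitSpan_le_homogeneousSubmodule 10), map_kronecker_hitSpan]
    rw [(Submodule.equivMapOfInjective _ injective_kronecker_domRestrict _).finrank_eq, hmap,
      finrank_codeSpan_of_leadsDistinct leadsDistinct_hitBasis_and_length.1,
      leadsDistinct_hitBasis_and_length.2]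
  have := ((hitSpan 10).comap H.subtype).finrank_quotient_add_finrank
  omega
end
end

section
/- The classes in (QP_5)_9 of the six monomials x_1x_2x_3x_4^2x_5^4, x_1x_2x_3^2x_4x_5^4, x_1x_2x_3^2x_4^4x_5, x_1x_2^2x_3x_4x_5^4, x_1x_2^2x_3x_4^4x_5, x_1x_2^2x_3^4x_4x_5 are linearly independent over F_2; that is, no nonzero F_2-linear combination of these six monomials is hit. -/
open MvPolynomial

noncomputable section

/-- If `k + j` is one less than a power of two and `j ≠ 0`, then `k` choose `j` is even. -/
theorem choose_even_of_add_eq_two_pow_sub_one (a : ℕ) :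
    ∀ k j : ℕ, k + j + 1 = 2 ^ a → j ≠ 0 → (k.choose j) % 2 = 0 := by
  induction a with
  | zero => intro k j h hj; simp at h; omega
  | succ a ih =>
    intro k j h hj
    have lucas := Choose.choose_modEq_choose_mod_mul_choose_div_nat (n := k) (k := j) (p := 2)
    rw [pow_succ] at h
    unfold Nat.ModEq at lucas
    rw [lucas]
    rcases Nat.mod_two_eq_zero_or_one k with hk | hk
    · have hj1 : j % 2 = 1 := by omega
      simp [hk, hj1]
    · rw [Nat.mul_mod, ih (k / 2) (j / 2) (by omega) (by omega)]
      simp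

theorem Sq_monomial (m : Fin 5 →₀ ℕ) :
    Sq (monomial m 1) = ∑ k ∈ Fintype.piFinset fun i => Finset.range (m i + 1),
      monomial (m + Finsupp.equivFunOnFinite.symm k) (∏ i, ((m i).choose (k i) : ZMod 2)) := by
  have expand (i : Fin 5) : ((X i : P5) + X i ^ 2) ^ m i =
      ∑ k ∈ Finset.range (m i + 1), C ((m i).choose k : ZMod 2) * X i ^ (m i + k) := by
    rw [add_comm, add_pow]
    refine Finset.sum_congr rfl fun k hk => ?_
    have hk' : k ≤ m i := Nat.lt_succ_iff.mp (Finset.mem_range.mp hk)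
    rw [← pow_mul, ← pow_add, mul_comm, map_natCast]
    congr 2
    omega
  rw [Sq, aeval_monomial, map_one, one_mul, Finsupp.prod_fintype _ _ (fun _ => pow_zero _)]
  simp_rw [expand]
  rw [Finset.prod_univ_sum]
  refine Finset.sum_congr rfl fun k _ => ?_
  rw [Finset.prod_mul_distrib, ← map_prod, monomial_eq,
    Finsupp.prod_fintype _ _ (fun _ => pow_zero _)]
  simp

/-- A spike, i.e. a monomial all of whose exponents are of the form `2 ^ a - 1`, does not occur
in the total square of any other monomial. -/
theorem coeff_spike_Sq_monomial {e m : Fin 5 →₀ ℕ} (he : ∀ i, ∃ a, e i + 1 = 2 ^ a)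
    (hm : m ≠ e) : coeff e (Sq (monomial m 1)) = 0 := by
  rw [Sq_monomial, coeff_sum]
  refine Finset.sum_eq_zero fun k _ => ?_
  rw [coeff_monomial]
  split_ifs with h
  · obtain ⟨i, hi⟩ : ∃ i, m i ≠ e i := by
      by_contra! hall
      exact hm (Finsupp.ext hall)
    obtain ⟨a, ha⟩ := he i
    have hki : m i + k i = e i := by rw [← h]; simp
    refine Finset.prod_eq_zero (Finset.mem_univ i) ?_
    rw [ZMod.natCast_eq_zero_iff]
    exact Nat.dvd_of_mod_eq_zero
      (choose_even_of_add_eq_two_pow_sub_one a _ _ (by omega) (by omega))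
  · rfl

theorem coeff_spike_Sq {e : Fin 5 →₀ ℕ} (he : ∀ i, ∃ a, e i + 1 = 2 ^ a) {g : P5}
    (hg : coeff e g = 0) : coeff e (Sq g) = 0 := by
  rw [g.as_sum, map_sum, coeff_sum]
  refine Finset.sum_eq_zero fun m hm => ?_
  have hne : m ≠ e := fun h => mem_support_iff.mp hm (h ▸ hg)
  rw [← mul_one (coeff m g), ← smul_eq_mul, ← smul_monomial, map_smul, coeff_smul,
    coeff_spike_Sq_monomial he hne, smul_zero]

theorem rename_Sq (σ : Fin 5 → Fin 5) (g : P5) : rename σ (Sq g) = Sq (rename σ g) := by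
  have : (rename σ).comp Sq = Sq.comp (rename σ) := by
    ext1 i
    simp [Sq]
  exact DFunLike.congr_fun this g

/-- Spikes do not occur in hit polynomials, even after identifying variables. -/
theorem IsHit.coeff_spike_rename {n : ℕ} {f : P5} (hf : IsHit n f) (σ : Fin 5 → Fin 5)
    {e : Fin 5 →₀ ℕ} (he : ∀ i, ∃ a, e i + 1 = 2 ^ a) (hn : e.degree = n) :
    coeff e (rename σ f) = 0 := by
  obtain ⟨g, hg, rfl⟩ := hf
  rw [rename_homogeneousComponent, coeff_homogeneousComponent, if_pos hn, rename_Sq]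
  refine coeff_spike_Sq he ?_
  have h := congrArg (coeff e) (rename_homogeneousComponent (φ := σ) n g).symm
  rwa [hg n le_rfl, map_zero, coeff_homogeneousComponent, if_pos hn, coeff_zero] at h

theorem mon_eq_monomial_s10 (a b c d e : ℕ) :
    mon a b c d e = monomial (Finsupp.equivFunOnFinite.symm ![a, b, c, d, e]) 1 := by
  rw [monomial_eq, Finsupp.prod_fintype _ _ (fun _ => pow_zero _)]
  simp [mon, Fin.prod_univ_five]

theorem coeff_rename_mon (σ : Fin 5 → Fin 5) (v : Fin 5 → ℕ) (a b c d e : ℕ) :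
    coeff (Finsupp.equivFunOnFinite.symm v) (rename σ (mon a b c d e)) =
      if ∀ i, ∑ j with σ j = i, ![a, b, c, d, e] j = v i then 1 else 0 := by
  rw [mon_eq_monomial_s10, rename_monomial, coeff_monomial]
  refine if_congr ?_ rfl rfl
  simp only [DFunLike.ext_iff, Finsupp.equivFunOnFinite_symm_apply_apply]
  refine forall_congr' fun i => ?_
  rw [Finsupp.mapDomain, Finsupp.sum_fintype _ _ (fun _ => Finsupp.single_zero _),
    Finsupp.finsetSum_apply]
  simp [Finsupp.single_apply, Finset.sum_filter]

/-- The substitution sending all variables except `x_p` and `x_q` to `x_1`. -/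
def collapse (p q i : Fin 5) : Fin 5 := if i = p ∨ i = q then i else 0

/-- The classes of the six listed monomials are linearly independent in `(QP_5)_9`. -/
theorem stmt10 (c : Fin 6 → ZMod 2)
    (h : IsHit 9 (∑ i, c i •
      ![mon 1 1 1 2 4, mon 1 1 2 1 4, mon 1 1 2 4 1,
        mon 1 2 1 1 4, mon 1 2 1 4 1, mon 1 2 4 1 1] i)) :
    ∀ i, c i = 0 := by
  have spike (p q : Fin 5) (hp : p ≠ 0) (hq : q ≠ 0) (hpq : p ≠ q) :=
    h.coeff_spike_rename (collapse p q)
      (e := Finsupp.equivFunOnFinite.symm fun i =>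
        if i = 0 then 7 else if i = p ∨ i = q then 1 else 0)
      (fun i => by
        simp only [Finsupp.equivFunOnFinite_symm_apply_apply]
        split_ifs
        exacts [⟨3, rfl⟩, ⟨1, rfl⟩, ⟨0, rfl⟩])
      (by
        rw [Finsupp.degree_eq_sum]
        simp only [Finsupp.equivFunOnFinite_symm_apply_apply]
        revert p q
        decide)
  simp only [map_add, map_smul, coeff_add, coeff_smul, Fin.sum_univ_six, Matrix.cons_val,
    coeff_rename_mon, smul_eq_mul] at spike
  have c0 := spike 1 2 (by decide) (by decide) (by decide)
  have c1 := spike 1 3 (by decide) (by decide) (by decide)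
  have c2 := spike 1 4 (by decide) (by decide) (by decide)
  have c3 := spike 2 3 (by decide) (by decide) (by decide)
  have c4 := spike 2 4 (by decide) (by decide) (by decide)
  have c5 := spike 3 4 (by decide) (by decide) (by decide)
  simp +decide only [if_true, if_false, mul_one, mul_zero, add_zero, zero_add]
    at c0 c1 c2 c3 c4 c5
  intro i
  fin_cases i <;> assumption
end
end
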